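/- Let G = F ∗ A₁ ∗ ⋯ ∗ A_k be the free product of a free group F of finite rank and finitely many free abelian groups A₁,…,A_k of finite ranks, with finite generating set B consisting of a basis of F together with bases of the A_i. There exists a constant N (depending only on G) such that for all integers g ≥ 1, m ≥ 1 and all elements C₁,…,C_{m−1}, C ∈ G: if there exist x₁,…,x_g, z₁,…,z_{m−1} ∈ G with (∏_{i=1}^{g} x_i²)·(∏_{j=1}^{m−1} z_j⁻¹ C_j z_j)·C = 1, then there exist such elements which additionally satisfy |x_i| ≤ N·s²⁰ and |z_j| ≤ N·s²⁰ for all i, j, where s = g + (m−1) + ∑_{j=1}^{m−1}|C_j| + |C|. -/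

import Mathlib

/- G = F ∗ A₁ ∗ ⋯ ∗ A_k : free product of a free group of finite rank r and
free abelian groups of finite ranks, with generating set B a basis of F together
with bases of the Aᵢ. -/

namespace Stmt3

/-- The family of factors: index `none` is the free group, `some i` the i-th free
abelian group (written multiplicatively). -/
def Fam (r k : ℕ) (ranks : Fin k → ℕ) : Option (Fin k) → Type
  | none => FreeGroup (Fin r)
  | some i => Multiplicative (Fin (ranks i) →₀ ℤ)

noncomputable instance (r k : ℕ) (ranks : Fin k → ℕ) : (i : Option (Fin k)) → Group (Fam r k ranks i)
  | none => inferInstanceAs (Group (FreeGroup (Fin r)))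
  | some i => inferInstanceAs (Group (Multiplicative (Fin (ranks i) →₀ ℤ)))

/-- The free product G = F ∗ A₁ ∗ ⋯ ∗ A_k. -/
abbrev G (r k : ℕ) (ranks : Fin k → ℕ) : Type := Monoid.CoprodI (Fam r k ranks)

/-- The generating set: a basis of F together with a basis of each Aᵢ. -/
abbrev B (r k : ℕ) (ranks : Fin k → ℕ) : Type := Fin r ⊕ (Σ i : Fin k, Fin (ranks i))

/-- The generators of G indexed by B. -/
noncomputable def gen (r k : ℕ) (ranks : Fin k → ℕ) : B r k ranks → G r k ranks
  | Sum.inl j => Monoid.CoprodI.of (M := Fam r k ranks) (i := none)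
      (show Fam r k ranks none from FreeGroup.of j)
  | Sum.inr ⟨i, j⟩ => Monoid.CoprodI.of (M := Fam r k ranks) (i := some i)
      (show Fam r k ranks (some i) from Multiplicative.ofAdd (Finsupp.single j (1 : ℤ)))

/-- Word length of an element of G with respect to the generating set B:
the least n such that the element is a product of n elements of B ∪ B⁻¹. -/
noncomputable def wl (r k : ℕ) (ranks : Fin k → ℕ) (x : G r k ranks) : ℕ :=
  sInf {n | ∃ l : List (G r k ranks), l.length = n ∧
    (∀ y ∈ l, ∃ b, y = gen r k ranks b ∨ y = (gen r k ranks b)⁻¹) ∧ l.prod = x}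

end Stmt3

section
set_option linter.unusedSectionVars false

namespace Stmt3

/-- Words in signed tokens. -/
abbrev Wd (τ : Type) := List (τ × Bool)

section words
variable {τ : Type} {H : Type} [Group H]

/-- Value of a signed token. -/
def tv (f : τ → H) (p : τ × Bool) : H := cond p.2 (f p.1) (f p.1)⁻¹

/-- Value of a word. -/
def ev (f : τ → H) (L : Wd τ) : H := (L.map (tv f)).prod

/-- Formal inverse of a word. -/
def iv (L : Wd τ) : Wd τ := (L.map (fun p => (p.1, !p.2))).reverse

/-- Number of occurrences of a token in a word. -/
def occ [DecidableEq τ] (t : τ) (L : Wd τ) : ℕ := (L.map Prod.fst).count t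

@[simp] lemma ev_nil (f : τ → H) : ev f [] = 1 := rfl
@[simp] lemma ev_cons (f : τ → H) (p) (L : Wd τ) : ev f (p :: L) = tv f p * ev f L := by
  simp [ev]
@[simp] lemma ev_append (f : τ → H) (L L' : Wd τ) : ev f (L ++ L') = ev f L * ev f L' := by
  simp [ev]
lemma tv_not (f : τ → H) (t : τ) (b : Bool) : tv f (t, !b) = (tv f (t, b))⁻¹ := by
  cases b <;> simp [tv]
@[simp] lemma ev_iv (f : τ → H) (L : Wd τ) : ev f (iv L) = (ev f L)⁻¹ := by
  induction L with
  | nil => simp [iv]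
  | cons p L ih =>
    have : iv (p :: L) = iv L ++ [(p.1, !p.2)] := by simp [iv]
    rw [this, ev_append, ih]
    obtain ⟨t, b⟩ := p
    simp [tv_not]
lemma ev_flatten (f : τ → H) (S : List (Wd τ)) : ev f S.flatten = (S.map (ev f)).prod := by
  induction S with
  | nil => simp
  | cons T S ih => simp [ih]

lemma ev_congr {f f' : τ → H} {L : Wd τ} (h : ∀ p ∈ L, f p.1 = f' p.1) : ev f L = ev f' L := by
  unfold ev
  congr 1
  apply List.map_congr_left
  intro p hp
  simp [tv, h p hp]

lemma ev_hom {K : Type} [Group K] (φ : H →* K) (f : τ → H) (L : Wd τ) :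
    φ (ev f L) = ev (fun t => φ (f t)) L := by
  induction L with
  | nil => simp
  | cons p L ih =>
    obtain ⟨t, b⟩ := p
    cases b <;> simp [ih, tv]

lemma ev_map {σ : Type} (φ : σ → τ) (f : τ → H) (L : Wd σ) :
    ev f (L.map (fun p => (φ p.1, p.2))) = ev (fun t => f (φ t)) L := by
  induction L with
  | nil => simp
  | cons p L ih =>
    obtain ⟨t, b⟩ := p
    cases b <;> simp [ih, tv]

@[simp] lemma iv_length (L : Wd τ) : (iv L).length = L.length := by simp [iv]
lemma mem_iv_fst (L : Wd τ) (p) (h : p ∈ iv L) : ∃ q ∈ L, q.1 = p.1 := by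
  simp only [iv, List.mem_reverse, List.mem_map] at h
  obtain ⟨a, ha, rfl⟩ := h
  exact ⟨a, ha, rfl⟩

variable [DecidableEq τ]

@[simp] lemma occ_nil (t : τ) : occ t [] = 0 := rfl
@[simp] lemma occ_append (t : τ) (L L' : Wd τ) : occ t (L ++ L') = occ t L + occ t L' := by
  simp [occ]
@[simp] lemma occ_cons (t : τ) (p) (L : Wd τ) :
    occ t (p :: L) = (if p.1 = t then 1 else 0) + occ t L := by
  simp [occ, List.count_cons, add_comm]
@[simp] lemma occ_iv (t : τ) (L : Wd τ) : occ t (iv L) = occ t L := by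
  simp only [occ, iv, List.map_reverse, List.count_reverse, List.map_map]
  rfl
lemma occ_pos {t : τ} {L : Wd τ} : 0 < occ t L ↔ ∃ p ∈ L, p.1 = t := by
  unfold occ
  rw [List.count_pos_iff]
  simp only [List.mem_map]
lemma occ_zero {t : τ} {L : Wd τ} : occ t L = 0 ↔ ∀ p ∈ L, p.1 ≠ t := by
  unfold occ
  rw [List.count_eq_zero]
  simp only [List.mem_map, not_exists, not_and]
lemma occ_split {t : τ} {L : Wd τ} (h : 0 < occ t L) :
    ∃ A ε B, L = A ++ (t, ε) :: B := by
  obtain ⟨⟨a, b⟩, hp, rfl⟩ := occ_pos.1 h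
  obtain ⟨A, B, rfl⟩ := List.append_of_mem hp
  exact ⟨A, b, B, rfl⟩

lemma ev_update {f : τ → H} {t : τ} {v : H} {L : Wd τ} (h : occ t L = 0) :
    ev (Function.update f t v) L = ev f L := by
  apply ev_congr
  intro p hp
  rw [Function.update_of_ne]
  exact occ_zero.1 h p hp

/-- Every sign and value can be realised. -/
lemma ev_filter (f : τ → H) (q : τ → Prop) [DecidablePred q] (L : Wd τ)
    (h : ∀ t, ¬ q t → f t = 1) :
    ev f (L.filter (fun p => q p.1)) = ev f L := by
  induction L with
  | nil => simp
  | cons p L ih =>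
    by_cases hp : q p.1
    · simp [hp, ih]
    · have : tv f p = 1 := by
        obtain ⟨t, b⟩ := p
        cases b <;> simp [tv, h t hp]
      simp [hp, ih, this]

lemma occ_filter (q : τ → Prop) [DecidablePred q] (t : τ) (L : Wd τ) :
    occ t (L.filter (fun p => q p.1)) = if q t then occ t L else 0 := by
  induction L with
  | nil => simp
  | cons p L ih =>
    by_cases hp : q p.1
    · simp only [hp, decide_true, List.filter_cons_of_pos, occ_cons, ih]
      by_cases ht : q t
      · simp [ht]
      · have : p.1 ≠ t := fun h => ht (h ▸ hp)
        simp [ht, this]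
    · simp only [hp, decide_false, Bool.false_eq_true, not_false_eq_true, List.filter_cons_of_neg, ih, occ_cons]
      by_cases ht : q t
      · have : p.1 ≠ t := fun h => hp (h ▸ ht)
        simp [ht, this]
      · simp [ht]

end words

/-- Central elements of exponent two. -/
def CI {H : Type} [Group H] (k : H) : Prop := k * k = 1 ∧ ∀ h, k * h = h * k

lemma CI.one {H : Type} [Group H] : CI (1 : H) := ⟨by simp, by simp⟩

/-- Merging lemma. -/
lemma merge {τ ι : Type} [DecidableEq τ] (m : τ → Prop) (κ : τ → ι) (n : ℕ) :
    ∀ S : List (Wd τ), S.length = n → (∀ y, m y → occ y S.flatten ≤ 2) →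
    ∃ S' : List (Wd τ),
      S'.Pairwise (fun T T' => ∀ y, m y → 0 < occ y T → occ y T' = 0) ∧
      (∀ y, occ y S'.flatten = occ y S.flatten ∨ (m y ∧ occ y S'.flatten = 0)) ∧
      S'.flatten.length ≤ S.flatten.length ∧
      ((∀ T ∈ S, ∃ i, ∀ p ∈ T, κ p.1 = i) → (∀ T ∈ S', ∃ i, ∀ p ∈ T, κ p.1 = i)) ∧
      (∀ (H : Type) [Group H] (f : τ → H), (∀ T ∈ S, ev f T = 1) → ∀ T ∈ S', ev f T = 1) ∧
      (∀ (H : Type) [Group H] (f' : τ → H), (∀ T ∈ S', CI (ev f' T)) →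
        ∃ f : τ → H, (∀ y, ¬ m y → f y = f' y) ∧ (∀ T ∈ S, CI (ev f T)) ∧
          (S.map (ev f)).prod = (S'.map (ev f')).prod) := by
  induction n with
  | zero =>
    intro S hS _
    obtain rfl := List.length_eq_zero_iff.1 hS
    exact ⟨[], by simp, by simp, by simp, by simp, by simp, fun H _ f' _ => ⟨f', by simp⟩⟩
  | succ n ih =>
    intro S hS hocc
    by_cases hp : S.Pairwise (fun T T' => ∀ y, m y → 0 < occ y T → occ y T' = 0)
    · exact ⟨S, hp, by simp, le_rfl, fun h => h, fun H _ f h => h,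
        fun H _ f' h => ⟨f', by simp, h, rfl⟩⟩
    -- find two faces sharing a token
    have hex : ∃ S1 T S2 T' S3 y, S = S1 ++ T :: (S2 ++ T' :: S3) ∧ m y ∧ 0 < occ y T ∧
        0 < occ y T' := by
      clear hocc hS ih
      induction S with
      | nil => simp at hp
      | cons T S ihS =>
        rw [List.pairwise_cons] at hp
        by_cases h1 : ∀ a' ∈ S, ∀ y, m y → 0 < occ y T → occ y a' = 0
        · have := ihS (fun h => hp ⟨h1, h⟩)
          obtain ⟨S1, T1, S2, T', S3, y, h, h'⟩ := this
          exact ⟨T :: S1, T1, S2, T', S3, y, by simp [h], h'⟩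
        · push Not at h1
          obtain ⟨T', hT', y, hy, h2, h3⟩ := h1
          obtain ⟨S2, S3, rfl⟩ := List.append_of_mem hT'
          exact ⟨[], T, S2, T', S3, y, by simp, hy, h2, Nat.pos_of_ne_zero h3⟩
    obtain ⟨S1, T, S2, T', S3, y, rfl, hy, hT, hT'⟩ := hex
    obtain ⟨A, ε, B, rfl⟩ := occ_split hT
    obtain ⟨A', δ, B', rfl⟩ := occ_split hT'
    have hocy := hocc y hy
    simp only [List.flatten_append, List.flatten_cons, occ_append, occ_cons, if_true] at hocy
    have z1 : occ y S1.flatten = 0 := by omega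
    have z2 : occ y A = 0 := by omega
    have z3 : occ y B = 0 := by omega
    have z4 : occ y S2.flatten = 0 := by omega
    have z5 : occ y A' = 0 := by omega
    have z6 : occ y B' = 0 := by omega
    have z7 : occ y S3.flatten = 0 := by omega
    clear hocy
    -- the middle word replacing the token
    obtain ⟨Q, hQocc, hQlen, hQmem, hQev⟩ : ∃ Q : Wd τ, (∀ t, occ t Q = occ t A' + occ t B') ∧
        Q.length = A'.length + B'.length ∧ (∀ p ∈ Q, ∃ q ∈ A' ++ B', q.1 = p.1) ∧
        (∀ (H : Type) [Group H] (f : τ → H), ev f (A' ++ (y, δ) :: B') = 1 ↔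
          tv f (y, ε) = ev f Q) := by
      by_cases h : δ = ε
      · subst h
        refine ⟨iv A' ++ iv B', by simp, by simp, ?_, ?_⟩
        · intro p hp
          rcases List.mem_append.1 hp with h | h <;> obtain ⟨q, hq, e⟩ := mem_iv_fst _ _ h
          · exact ⟨q, by simp [hq], e⟩
          · exact ⟨q, by simp [hq], e⟩
        · intro H _ f
          simp only [ev_append, ev_cons, ev_iv]
          constructor
          · intro h
            rw [eq_inv_mul_iff_mul_eq, eq_inv_iff_mul_eq_one, ← h]; group
          · intro h
            rw [h]; group
      · have h' : δ = !ε := by cases δ <;> cases ε <;> simp_all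
        subst h'
        refine ⟨B' ++ A', by simp [add_comm], by simp [add_comm], ?_, ?_⟩
        · intro p hp
          exact ⟨p, by simp at hp ⊢; tauto, rfl⟩
        · intro H _ f
          simp only [ev_append, ev_cons, tv_not]
          constructor
          · intro h
            have : (tv f (y, ε))⁻¹ = (ev f A')⁻¹ * (ev f B')⁻¹ := by
              rw [eq_inv_mul_iff_mul_eq, eq_inv_iff_mul_eq_one, ← h]; group
            rw [← inv_inj, this]; group
          · intro h
            rw [h]; group
    have hzQ : occ y Q = 0 := by rw [hQocc]; omega
    obtain ⟨S', c1, c2, c3, c4, c5, c6⟩ := ih (S1 ++ (A ++ Q ++ B) :: (S2 ++ S3))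
      (by simp at hS ⊢; omega)
      (by
        intro t ht
        have := hocc t ht
        simp only [List.flatten_append, List.flatten_cons, occ_append, occ_cons, hQocc] at this ⊢
        omega)
    refine ⟨S', c1, ?_, ?_, ?_, ?_, ?_⟩
    · intro t
      have h2 := c2 t
      by_cases hty : y = t
      · subst hty
        right
        refine ⟨hy, ?_⟩
        rcases h2 with h | h
        · rw [h]; simp [*]
        · exact h.2
      · simp only [List.flatten_append, List.flatten_cons, occ_append, occ_cons, hQocc, if_neg hty] at h2 ⊢
        rcases h2 with h | h
        · left; rw [h]; omega
        · right; exact h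
    · refine c3.trans ?_
      simp [hQlen]; omega
    · intro h
      apply c4
      intro T hTm
      simp only [List.mem_append, List.mem_cons] at hTm
      rcases hTm with h1 | rfl | h1 | h1
      · exact h T (by simp [h1])
      · obtain ⟨i, hi⟩ := h (A ++ (y, ε) :: B) (by simp)
        obtain ⟨i', hi'⟩ := h (A' ++ (y, δ) :: B') (by simp)
        have e1 := hi (y, ε) (by simp)
        have e2 := hi' (y, δ) (by simp)
        have e : i' = i := by rw [← e1, ← e2]
        subst e
        refine ⟨i', ?_⟩
        intro p hp
        simp only [List.mem_append] at hp
        rcases hp with (h1 | h1) | h1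
        · exact hi p (by simp [h1])
        · obtain ⟨q, hq, e⟩ := hQmem p h1
          rw [← e]
          exact hi' q (by simp at hq ⊢; tauto)
        · exact hi p (by simp [h1])
      · exact h T (by simp [h1])
      · exact h T (by simp [h1])
    · intro H _ f h
      apply c5
      intro T hTm
      simp only [List.mem_append, List.mem_cons] at hTm
      rcases hTm with h1 | rfl | h1 | h1
      · exact h T (by simp [h1])
      · have e1 := h (A ++ (y, ε) :: B) (by simp)
        have e2 := (hQev H f).1 (h (A' ++ (y, δ) :: B') (by simp))
        simp only [ev_append, ev_cons] at e1 ⊢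
        rw [← e2, mul_assoc, e1]
      · exact h T (by simp [h1])
      · exact h T (by simp [h1])
    · intro H _ f' h
      obtain ⟨f, d1, d2, d3⟩ := c6 H f' h
      set v : H := cond ε (ev f Q) (ev f Q)⁻¹ with hv
      set F := Function.update f y v with hF
      have hFy : tv F (y, ε) = ev f Q := by
        simp [tv, hF, hv]; cases ε <;> simp
      have up : ∀ L : Wd τ, occ y L = 0 → ev F L = ev f L := fun L hL => ev_update hL
      have upl : ∀ S : List (Wd τ), occ y S.flatten = 0 → ∀ T ∈ S, ev F T = ev f T := by
        intro S hS T hT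
        apply up
        rw [occ_zero] at hS ⊢
        intro p hp
        exact hS p (by simp; exact ⟨T, hT, hp⟩)
      have e2 : ev F (A' ++ (y, δ) :: B') = 1 := by
        rw [hQev, hFy, up Q hzQ]
      have e1 : ev F (A ++ (y, ε) :: B) = ev f (A ++ Q ++ B) := by
        simp only [ev_append, ev_cons, hFy, up A z2, up B z3, mul_assoc]
      refine ⟨F, ?_, ?_, ?_⟩
      · intro t ht
        have : t ≠ y := fun h => ht (h ▸ hy)
        rw [hF, Function.update_of_ne this, d1 t ht]
      · intro T hTm
        simp only [List.mem_append, List.mem_cons] at hTm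
        rcases hTm with h1 | rfl | h1 | rfl | h1
        · rw [upl S1 z1 T h1]; exact d2 T (by simp [h1])
        · rw [e1]; exact d2 _ (by simp)
        · rw [upl S2 z4 T h1]; exact d2 T (by simp [h1])
        · rw [e2]; exact CI.one
        · rw [upl S3 z7 T h1]; exact d2 T (by simp [h1])
      · rw [← d3]
        simp only [List.map_append, List.map_cons, List.prod_append, List.prod_cons, e1, e2]
        rw [List.map_congr_left (upl S1 z1), List.map_congr_left (upl S2 z4),
          List.map_congr_left (upl S3 z7)]
        simp [mul_assoc]

end Stmt3
end

section
namespace Stmt3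

open Monoid

/-- If no consecutive monochrome nonempty block is trivial, we get a reduced word. -/
lemma block_aux {ι A : Type} [DecidableEq ι] [Group A] (n : ℕ) : ∀ L : List (ι × A), L.length ≤ n →
    (∀ P T Q, L = P ++ T ++ Q → T ≠ [] → (∃ i, ∀ p ∈ T, p.1 = i) → (T.map Prod.snd).prod ≠ 1) →
    ∃ w : CoprodI.Word (fun _ : ι => A),
      w.prod = (L.map (fun p => CoprodI.of (M := fun _ : ι => A) (i := p.1) p.2)).prod ∧
      w.fstIdx = L.head?.map Prod.fst := by
  induction n with
  | zero =>
    intro L hL _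
    obtain rfl := List.length_eq_zero_iff.1 (Nat.le_zero.1 hL)
    exact ⟨CoprodI.Word.empty, by simp, by simp [CoprodI.Word.fstIdx]⟩
  | succ n ih =>
    intro L hL hno
    match L, hL, hno with
    | [], _, _ => exact ⟨CoprodI.Word.empty, by simp, by simp [CoprodI.Word.fstIdx]⟩
    | (i, a) :: L, hL, hno =>
      set T := L.takeWhile (fun p => decide (p.1 = i)) with hT
      set R := L.dropWhile (fun p => decide (p.1 = i)) with hR
      have hTR : T ++ R = L := List.takeWhile_append_dropWhile
      have hTi : ∀ p ∈ T, p.1 = i := by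
        intro p hp
        have := List.mem_takeWhile_imp hp
        simpa using this
      obtain ⟨w, hw1, hw2⟩ := ih R (by
          have : R.length ≤ L.length := by rw [← hTR]; simp
          simp at hL; omega) (by
          intro P T' Q h
          apply hno ((i, a) :: T ++ P) T' Q
          rw [← hTR, h]; simp)
      have hne : a * (T.map Prod.snd).prod ≠ 1 := by
        have := hno [] ((i, a) :: T) R (by simp [hTR]) (by simp) ⟨i, by
          intro p hp
          rcases List.mem_cons.1 hp with rfl | hp
          · rfl
          · exact hTi p hp⟩
        simpa using this
      have hidx : w.fstIdx ≠ some i := by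
        rw [hw2]
        cases hRc : R with
        | nil => simp
        | cons q R' =>
          have := List.head?_dropWhile_not (fun p : ι × A => decide (p.1 = i)) L
          rw [← hR, hRc] at this
          simpa using this
      have hTp : ∀ T : List (ι × A), (∀ p ∈ T, p.1 = i) →
          (T.map (fun p => CoprodI.of (M := fun _ : ι => A) (i := p.1) p.2)).prod =
          CoprodI.of (M := fun _ : ι => A) (i := i) (T.map Prod.snd).prod := by
        intro T
        induction T with
        | nil => simp
        | cons p T ih =>
          intro h
          have h1 := h p (by simp)
          obtain ⟨j, b⟩ := p
          simp only at h1
          subst h1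
          have := ih (fun p hp => h p (by simp [hp]))
          simp only [List.map_cons, List.prod_cons, this]
          rw [← map_mul]
      refine ⟨CoprodI.Word.cons (a * (T.map Prod.snd).prod) w hidx hne, ?_, ?_⟩
      · rw [CoprodI.Word.prod_cons, hw1, ← hTR]
        simp only [List.map_cons, List.map_append, List.prod_cons, List.prod_append]
        rw [hTp T hTi, map_mul]
        simp [mul_assoc]
      · simp [CoprodI.Word.fstIdx, CoprodI.Word.cons]

lemma block {ι A : Type} [DecidableEq ι] [Group A] (L : List (ι × A)) (hL : L ≠ [])
    (h : (L.map (fun p => CoprodI.of (M := fun _ : ι => A) (i := p.1) p.2)).prod = 1) :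
    ∃ P T Q, L = P ++ T ++ Q ∧ T ≠ [] ∧ (∃ i, ∀ p ∈ T, p.1 = i) ∧ (T.map Prod.snd).prod = 1 := by
  classical
  by_contra hc
  push Not at hc
  obtain ⟨w, h1, h2⟩ := block_aux L.length L le_rfl (by
    intro P T Q a b c
    obtain ⟨i, hi⟩ := c
    exact hc P T Q a b ⟨i, hi⟩)
  rw [h] at h1
  have : w = CoprodI.Word.empty := by
    apply CoprodI.Word.equiv.symm.injective
    show w.prod = CoprodI.Word.empty.prod
    rw [h1]; simp
  rw [this] at h2
  cases L with
  | nil => exact hL rfl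
  | cons p L => simp [CoprodI.Word.fstIdx, CoprodI.Word.empty] at h2

/-- Splitting into monochrome trivial faces. -/
lemma split {τ ι A : Type} [DecidableEq τ] [DecidableEq ι] [Group A] (κ : τ → ι) (u : τ → A) (n : ℕ) :
    ∀ L : Wd τ, L.length ≤ n →
    ev (fun t => CoprodI.of (M := fun _ : ι => A) (i := κ t) (u t)) L = 1 →
    ∃ S : List (Wd τ), (∀ T ∈ S, (∃ i, ∀ p ∈ T, κ p.1 = i) ∧ ev u T = 1) ∧
      (∀ t, occ t S.flatten = occ t L) ∧ S.flatten.length = L.length ∧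
      (∀ (H : Type) [Group H] (f : τ → H), (∀ T ∈ S, CI (ev f T)) →
        ev f L = (S.map (ev f)).prod) := by
  induction n with
  | zero =>
    intro L hL _
    obtain rfl := List.length_eq_zero_iff.1 (Nat.le_zero.1 hL)
    exact ⟨[], by simp, by simp, by simp, by simp⟩
  | succ n ih =>
    intro L hL h
    by_cases hLn : L = []
    · subst hLn
      exact ⟨[], by simp, by simp, by simp, by simp⟩
    let L' : List (ι × A) := L.map (fun p => (κ p.1, tv u p))
    have hL' : (L'.map (fun p => CoprodI.of (M := fun _ : ι => A) (i := p.1) p.2)).prod = 1 := by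
      rw [← h]
      simp only [L', List.map_map, ev]
      congr 1
      apply List.map_congr_left
      rintro ⟨t, b⟩ _
      cases b <;> simp [tv]
    obtain ⟨P', T', Q', e, hTne, ⟨i, hi⟩, hT1⟩ := block L' (by simp [L', hLn]) hL'
    obtain ⟨X, Q, rfl, hX, rfl⟩ := List.map_eq_append_iff.1 e
    obtain ⟨P, T, rfl, rfl, rfl⟩ := List.map_eq_append_iff.1 hX
    have hT1' : ev u T = 1 := by
      rw [← hT1]; simp [ev, Function.comp_def]
    have hmono : ∀ p ∈ T, κ p.1 = i := by
      intro p hp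
      exact hi (κ p.1, tv u p) (List.mem_map.2 ⟨p, hp, rfl⟩)
    have hTc : ev (fun t => CoprodI.of (M := fun _ : ι => A) (i := κ t) (u t)) T = 1 := by
      have : ev (fun t => CoprodI.of (M := fun _ : ι => A) (i := κ t) (u t)) T =
          ev (fun t => CoprodI.of (M := fun _ : ι => A) (i := i) (u t)) T := by
        apply ev_congr
        intro p hp
        rw [hmono p hp]
      rw [this, ← ev_hom (CoprodI.of (M := fun _ : ι => A) (i := i)), hT1', map_one]
    have hTpos : 0 < T.length := by
      rw [List.length_pos_iff]; simpa using hTne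
    obtain ⟨S, s1, s2, s3, s4⟩ := ih (P ++ Q) (by simp at hL ⊢; omega) (by
      simp only [ev_append, hTc, mul_one] at h ⊢
      exact h)
    refine ⟨T :: S, ?_, ?_, ?_, ?_⟩
    · intro T0 h0
      rcases List.mem_cons.1 h0 with rfl | h0
      · exact ⟨⟨i, hmono⟩, hT1'⟩
      · exact s1 T0 h0
    · intro t
      have := s2 t
      simp at this ⊢
      omega
    · simp at s3 ⊢
      omega
    · intro H _ f hf
      have h1 := s4 H f (fun T0 h0 => hf T0 (by simp [h0]))
      have hk := (hf T (by simp)).2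
      simp only [List.map_cons, List.prod_cons, ← h1, ev_append]
      rw [← hk (ev f P)]
      group

end Stmt3
end

section
namespace Stmt3

open Monoid

/-- Number of occurrences of coefficient tokens. -/
def nc {τ : Type} (isC : τ → Bool) (L : Wd τ) : ℕ := (L.filter (fun p => isC p.1 = true)).length

@[simp] lemma nc_nil {τ : Type} (isC : τ → Bool) : nc isC [] = 0 := rfl
@[simp] lemma nc_append {τ : Type} (isC : τ → Bool) (L L' : Wd τ) :
    nc isC (L ++ L') = nc isC L + nc isC L' := by simp [nc]
@[simp] lemma nc_cons {τ : Type} (isC : τ → Bool) (p) (L : Wd τ) :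
    nc isC (p :: L) = (if isC p.1 then 1 else 0) + nc isC L := by
  by_cases h : isC p.1 <;> simp [nc, h, add_comm]

lemma ev_mul {τ A : Type} [CommGroup A] (u v : τ → A) (L : Wd τ) :
    ev (fun t => u t * v t) L = ev u L * ev v L := by
  induction L with
  | nil => simp
  | cons p L ih =>
    have : tv (fun t => u t * v t) p = tv u p * tv v p := by
      obtain ⟨t, b⟩ := p
      cases b <;> simp [tv, mul_comm]
    simp only [ev_cons, ih, this]
    exact mul_mul_mul_comm _ _ _ _

lemma ev_square {τ A : Type} [DecidableEq τ] [CommGroup A] (u : τ → A) (n : ℕ) : ∀ L : Wd τ,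
    L.length ≤ n → (∀ t, occ t L = 0 ∨ occ t L = 2) →
    (∃ a, ev u L = a * a) ∧ (ev u L = 1 ∨ ∃ t ε, List.Sublist [(t, ε), (t, ε)] L) := by
  induction n with
  | zero =>
    intro L hL _
    obtain rfl := List.length_eq_zero_iff.1 (Nat.le_zero.1 hL)
    exact ⟨⟨1, by simp⟩, by simp⟩
  | succ n ih =>
    intro L hL ho
    match L, hL, ho with
    | [], _, _ => exact ⟨⟨1, by simp⟩, by simp⟩
    | (t, ε) :: L, hL, ho =>
      have h1 := ho t
      simp at h1
      obtain ⟨A1, δ, B1, rfl⟩ := occ_split (t := t) (L := L) (by omega)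
      obtain ⟨⟨a, ha⟩, h2⟩ := ih (A1 ++ B1) (by simp at hL ⊢; omega) (by
        intro s
        have h3 := ho s
        simp only [occ_cons, occ_append] at h1 h3 ⊢
        by_cases hs : t = s
        · subst hs; simp at h1 h3; omega
        · simp [hs] at h3; omega)
      have key : ev u ((t, ε) :: (A1 ++ (t, δ) :: B1)) = tv u (t, ε) * tv u (t, δ) * ev u (A1 ++ B1) := by
        simp only [ev_cons, ev_append]
        rw [mul_left_comm (ev u A1), mul_assoc]
      by_cases hδ : δ = ε
      · subst hδ
        refine ⟨⟨tv u (t, δ) * a, ?_⟩, Or.inr ⟨t, δ, ?_⟩⟩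
        · rw [key, ha]; exact mul_mul_mul_comm _ _ _ _
        · apply List.Sublist.cons_cons
          simp
      · have h' : δ = !ε := by cases δ <;> cases ε <;> simp_all
        subst h'
        rw [tv_not, mul_inv_cancel, one_mul] at key
        rw [key]
        refine ⟨⟨a, ha⟩, ?_⟩
        rcases h2 with h2 | ⟨s, σ, h2⟩
        · exact Or.inl h2
        · right
          refine ⟨s, σ, h2.trans ?_⟩
          apply List.Sublist.cons
          exact (List.Sublist.refl A1).append (List.sublist_cons_self _ _)

lemma ev_single {τ A : Type} [DecidableEq τ] [Group A] (q : τ) (ε : Bool) (w : A) (T : Wd τ)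
    (h2 : occ q T = 2) (hs : List.Sublist [(q, ε), (q, ε)] T) :
    ev (fun t => if t = q then w else 1) T = cond ε w w⁻¹ * cond ε w w⁻¹ := by
  rw [← ev_filter _ (fun t => t = q) T (by intro t ht; simp [ht])]
  have h3 := hs.filter (fun p => decide (p.1 = q))
  have h4 : (T.filter (fun p => decide (p.1 = q))).length = 2 := by
    rw [← h2, occ, List.count, List.countP_map, List.countP_eq_length_filter]
    congr 1
  have h5 := h3.eq_of_length (by rw [h4]; simp)
  rw [← h5]
  cases ε <;> simp [tv]

lemma ev_bound {τ B : Type} (isC : τ → Bool) (u : τ → Multiplicative (B →₀ ℤ))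
    (hu : ∀ t, isC t = true → ∀ b, |(u t).toAdd b| ≤ 1) (hu' : ∀ t, isC t = false → u t = 1)
    (L : Wd τ) (b : B) : |(ev u L).toAdd b| ≤ nc isC L := by
  induction L with
  | nil => simp
  | cons p L ih =>
    obtain ⟨t, s⟩ := p
    simp only [ev_cons, toAdd_mul, Finsupp.add_apply, nc_cons]
    have h1 : |(tv u (t, s)).toAdd b| ≤ (if isC t then 1 else 0 : ℕ) := by
      by_cases h : isC t
      · have := hu t h b
        cases s <;> simp [tv, h, this]
      · have := hu' t (by simpa using h)
        cases s <;> simp [tv, this, h]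
    push_cast at h1 ⊢
    exact (abs_add_le _ _).trans (add_le_add h1 ih)

lemma filter_or_length {α : Type} (p q : α → Bool) (L : List α) :
    (L.filter (fun a => p a || q a)).length ≤ (L.filter p).length + (L.filter q).length := by
  induction L with
  | nil => simp
  | cons a L ih =>
    by_cases hp : p a <;> by_cases hq : q a <;> simp [hp, hq] <;> omega

lemma reduce_face {τ B : Type} [DecidableEq τ] (isC : τ → Bool)
    (u : τ → Multiplicative (B →₀ ℤ)) (hu : ∀ t, isC t = true → ∀ b, |(u t).toAdd b| ≤ 1)
    (T : Wd τ) (ho : ∀ t, isC t = false → occ t T = 0 ∨ occ t T = 2) (hT : ev u T = 1) :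
    ∃ (keep : τ → Bool) (u' : τ → Multiplicative (B →₀ ℤ)),
      (∀ t, isC t = true → keep t = true ∧ u' t = u t) ∧
      ev u' (T.filter (fun p => keep p.1 = true)) = 1 ∧
      (T.filter (fun p => keep p.1 = true)).length ≤ 3 * nc isC T ∧
      (∀ t, isC t = false → ∀ b, |(u' t).toAdd b| ≤ nc isC T) := by
  classical
  set uC : τ → Multiplicative (B →₀ ℤ) := fun t => if isC t then u t else 1 with huC
  set uY : τ → Multiplicative (B →₀ ℤ) := fun t => if isC t then 1 else u t with huY
  have hCY : ev uC T * ev uY T = 1 := by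
    rw [← ev_mul, ← hT]
    congr 1
    funext t
    by_cases h : isC t <;> simp [huC, huY, h]
  have simpleCase : ev uC T = 1 → ∃ (keep : τ → Bool) (u' : τ → Multiplicative (B →₀ ℤ)),
      (∀ t, isC t = true → keep t = true ∧ u' t = u t) ∧
      ev u' (T.filter (fun p => keep p.1 = true)) = 1 ∧
      (T.filter (fun p => keep p.1 = true)).length ≤ 3 * nc isC T ∧
      (∀ t, isC t = false → ∀ b, |(u' t).toAdd b| ≤ nc isC T) := by
    intro h
    refine ⟨isC, uC, ?_, ?_, ?_, ?_⟩
    · intro t ht; simp [huC, ht]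
    · rw [ev_filter uC (fun t => isC t = true) T (by intro t ht; simp [huC, ht])]
      exact h
    · show nc isC T ≤ _; omega
    · intro t ht b; simp [huC, ht]
  have hYf : ev uY T = ev uY (T.filter (fun p => isC p.1 = false)) := by
    rw [ev_filter uY (fun t => isC t = false) T (by intro t ht; simp at ht; simp [huY, ht])]
  obtain ⟨⟨a, ha⟩, htw⟩ := ev_square uY _ (T.filter (fun p => isC p.1 = false)) le_rfl (by
    intro t
    rw [occ_filter (fun t => isC t = false)]
    by_cases h : isC t = false
    · simpa [h] using ho t h
    · simp [h])
  rw [← hYf] at ha htw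
  rcases htw with h1 | ⟨q, ε, hsub⟩
  · rw [h1, mul_one] at hCY
    exact simpleCase hCY
  by_cases hnc : nc isC T = 0
  · apply simpleCase
    rw [← ev_filter uC (fun t => isC t = true) T (by intro t ht; simp [huC, ht])]
    rw [List.length_eq_zero_iff.1 hnc]
    rfl
  have hqC : isC q = false := by
    have : (q, ε) ∈ T.filter (fun p => isC p.1 = false) := hsub.subset (by simp)
    simpa using (List.mem_filter.1 this).2
  have hsubT : List.Sublist [(q, ε), (q, ε)] T := hsub.trans List.filter_sublist
  have hq2 : occ q T = 2 := by
    rcases ho q hqC with h | h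
    · have : (q, ε) ∈ T := hsubT.subset (by simp)
      exact absurd rfl (occ_zero.1 h _ this)
    · exact h
  set w : Multiplicative (B →₀ ℤ) := cond ε a a⁻¹ with hw
  refine ⟨fun t => isC t || decide (t = q), fun t => uC t * (if t = q then w else 1), ?_, ?_, ?_, ?_⟩
  · intro t ht
    have : t ≠ q := by rintro rfl; simp [hqC] at ht
    simp [huC, ht, this]
  · rw [ev_filter _ (fun t => (isC t || decide (t = q)) = true) T]
    · rw [ev_mul, ev_single q ε w T hq2 hsubT]
      have : cond ε w w⁻¹ = a := by cases ε <;> simp [hw]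
      rw [this, ← ha, hCY]
    · intro t ht
      simp at ht
      simp [huC, ht]
  · have := filter_or_length (fun p : τ × Bool => isC p.1) (fun p => decide (p.1 = q)) T
    have h4 : (T.filter (fun p => decide (p.1 = q))).length = 2 := by
      rw [← hq2, occ, List.count, List.countP_map, List.countP_eq_length_filter]
      congr 1
    have h5 : (T.filter (fun p : τ × Bool => isC p.1)).length = nc isC T := by simp [nc]
    rw [h4, h5] at this
    simp only [Bool.decide_eq_true]
    omega
  · intro t ht b
    by_cases htq : t = q
    · subst htq
      simp only [huC, ht]
      simp
      have h6 := ev_bound isC uC (by intro t ht; simp [huC, ht]; exact hu t ht)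
        (by intro t ht; simp [huC, ht]) T b
      have h7 : ev uC T = (a * a)⁻¹ := by rw [← ha]; exact eq_inv_of_mul_eq_one_left hCY
      rw [h7] at h6
      simp at h6
      have h8 : |(w.toAdd b)| = |a.toAdd b| := by cases ε <;> simp [hw]
      rw [h8]
      rw [abs_le] at h6 ⊢
      omega
    · simp [huC, ht, htq]

lemma reduce_all {τ B : Type} [DecidableEq τ] (isC : τ → Bool)
    (u : τ → Multiplicative (B →₀ ℤ)) (hu : ∀ t, isC t = true → ∀ b, |(u t).toAdd b| ≤ 1)
    (S : List (Wd τ))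
    (hp : S.Pairwise (fun T T' => ∀ y, isC y = false → 0 < occ y T → occ y T' = 0))
    (ho : ∀ T ∈ S, ∀ t, isC t = false → occ t T = 0 ∨ occ t T = 2) (hT : ∀ T ∈ S, ev u T = 1) :
    ∃ (keep : τ → Bool) (u' : τ → Multiplicative (B →₀ ℤ)),
      (∀ t, isC t = true → keep t = true ∧ u' t = u t) ∧
      (∀ T ∈ S, ev u' (T.filter (fun p => keep p.1 = true)) = 1 ∧
      (T.filter (fun p => keep p.1 = true)).length ≤ 3 * nc isC T) ∧
      (∀ t, isC t = false → ∀ b, |(u' t).toAdd b| ≤ nc isC S.flatten) := by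
  induction S with
  | nil =>
    refine ⟨fun _ => true, fun t => if isC t then u t else 1, ?_, by simp, ?_⟩
    · intro t ht; simp [ht]
    · intro t ht b; simp [ht]
  | cons T0 S ih =>
    rw [List.pairwise_cons] at hp
    obtain ⟨k1, u1, a1, a2, a3⟩ := ih hp.2 (fun T h => ho T (by simp [h])) (fun T h => hT T (by simp [h]))
    obtain ⟨k0, u0, b1, b2, b3, b4⟩ := reduce_face isC u hu T0 (ho T0 (by simp)) (hT T0 (by simp))
    refine ⟨fun t => if isC t = false ∧ 0 < occ t T0 then k0 t else k1 t,
      fun t => if isC t = false ∧ 0 < occ t T0 then u0 t else u1 t, ?_, ?_, ?_⟩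
    · intro t ht
      simp [ht, a1 t ht]
    · have h0 : ∀ p ∈ T0, (if isC p.1 = false ∧ 0 < occ p.1 T0 then k0 p.1 else k1 p.1) = k0 p.1 ∧
          (if isC p.1 = false ∧ 0 < occ p.1 T0 then u0 p.1 else u1 p.1) = u0 p.1 := by
        intro p hp
        by_cases h : isC p.1
        · simp [h, a1 p.1 h, b1 p.1 h]
        · have : 0 < occ p.1 T0 := occ_pos.2 ⟨p, hp, rfl⟩
          simp [h, this]
      have h1 : ∀ T ∈ S, ∀ p ∈ T, (if isC p.1 = false ∧ 0 < occ p.1 T0 then k0 p.1 else k1 p.1) = k1 p.1 ∧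
          (if isC p.1 = false ∧ 0 < occ p.1 T0 then u0 p.1 else u1 p.1) = u1 p.1 := by
        intro T hTS p hpT
        have : ¬ (isC p.1 = false ∧ 0 < occ p.1 T0) := by
          rintro ⟨h2, h3⟩
          have h4 := hp.1 T hTS p.1 h2 h3
          exact occ_zero.1 h4 p hpT rfl
        simp only [if_neg this, and_self]
      have gen : ∀ T : Wd τ, ∀ (k k' : τ → Bool) (v v' : τ → Multiplicative (B →₀ ℤ)),
          (∀ p ∈ T, k p.1 = k' p.1 ∧ v p.1 = v' p.1) →
          ev v (T.filter (fun p => k p.1 = true)) = ev v' (T.filter (fun p => k' p.1 = true)) ∧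
          T.filter (fun p => k p.1 = true) = T.filter (fun p => k' p.1 = true) := by
        intro T k k' v v' h
        have e : T.filter (fun p => k p.1 = true) = T.filter (fun p => k' p.1 = true) := by
          apply List.filter_congr
          intro p hp
          simp [(h p hp).1]
        refine ⟨?_, e⟩
        rw [e]
        apply ev_congr
        intro p hp
        exact (h p (List.mem_filter.1 hp).1).2
      intro T hTm
      rcases List.mem_cons.1 hTm with rfl | hTm
      · obtain ⟨e1, e2⟩ := gen T (fun t => if isC t = false ∧ 0 < occ t T then k0 t else k1 t) k0
          (fun t => if isC t = false ∧ 0 < occ t T then u0 t else u1 t) u0 h0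
        refine ⟨e1.trans b2, ?_⟩
        rw [e2]; exact b3
      · obtain ⟨e1, e2⟩ := gen T (fun t => if isC t = false ∧ 0 < occ t T0 then k0 t else k1 t) k1
          (fun t => if isC t = false ∧ 0 < occ t T0 then u0 t else u1 t) u1 (h1 T hTm)
        refine ⟨e1.trans (a2 T hTm).1, ?_⟩
        rw [e2]; exact (a2 T hTm).2
    · intro t ht b
      have e0 := b4 t ht b
      have e1 := a3 t ht b
      simp only [List.flatten_cons, nc_append]
      push_cast
      split_ifs
      · omega
      · omega

/-- Splitting, merging along the variables and reducing. -/
lemma lemmaA {τ ι B : Type} [DecidableEq τ] [DecidableEq ι] (isC : τ → Bool) (κ : τ → ι)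
    (u : τ → Multiplicative (B →₀ ℤ)) (hu : ∀ t, isC t = true → ∀ b, |(u t).toAdd b| ≤ 1)
    (L : Wd τ)
    (hL : ev (fun t => CoprodI.of (M := fun _ : ι => Multiplicative (B →₀ ℤ)) (i := κ t) (u t)) L = 1)
    (ho : ∀ t, isC t = false → occ t L = 2) :
    ∃ (S : List (Wd τ)) (u' : τ → Multiplicative (B →₀ ℤ)),
      (∀ T ∈ S, (∃ i, ∀ p ∈ T, κ p.1 = i) ∧ ev u' T = 1) ∧
      (∀ t, isC t = true → u' t = u t ∧ occ t S.flatten = occ t L) ∧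
      (∀ t, isC t = false → occ t S.flatten = 0 ∨ occ t S.flatten = 2) ∧
      S.flatten.length ≤ 3 * nc isC L ∧
      (∀ t, isC t = false → ∀ b, |(u' t).toAdd b| ≤ nc isC L) ∧
      (∀ (H : Type) [Group H] (f' : τ → H), (∀ T ∈ S, CI (ev f' T)) →
        ∃ f : τ → H, (∀ t, isC t = true → f t = f' t) ∧ ev f L = (S.map (ev f')).prod) := by
  obtain ⟨S1, a1, a2, a3, a4⟩ := split κ u _ L le_rfl hL
  obtain ⟨S2, b1, b2, b3, b4, b5, b6⟩ := merge (fun t => isC t = false) κ _ S1 rfl (by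
    intro y hy; rw [a2, ho y hy])
  have hocc2 : ∀ t, isC t = false → occ t S2.flatten = 0 ∨ occ t S2.flatten = 2 := by
    intro t ht
    rcases b2 t with h | h
    · right; rw [h, a2, ho t ht]
    · left; exact h.2
  have hoccC : ∀ t, isC t = true → occ t S2.flatten = occ t L := by
    intro t ht
    rcases b2 t with h | h
    · rw [h, a2]
    · simp [ht] at h
  have hocc3 : ∀ T ∈ S2, ∀ t, isC t = false → occ t T = 0 ∨ occ t T = 2 := by
    intro T hT t ht
    by_cases h0 : occ t T = 0
    · exact Or.inl h0
    right
    have : occ t S2.flatten = occ t T := by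
      clear b2 b3 b4 b5 b6 hocc2 hoccC
      induction S2 with
      | nil => simp at hT
      | cons T0 S ih =>
        rw [List.pairwise_cons] at b1
        have key : ∀ S : List (Wd τ), (∀ T ∈ S, occ t T = 0) → occ t S.flatten = 0 := by
          intro S h
          rw [occ_zero]
          intro p hp
          obtain ⟨T, hT, hpT⟩ := List.mem_flatten.1 hp
          exact occ_zero.1 (h T hT) p hpT
        rcases List.mem_cons.1 hT with rfl | hT
        · simp only [List.flatten_cons, occ_append]
          rw [key S (fun T' h' => b1.1 T' h' t ht (Nat.pos_of_ne_zero h0))]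
          simp
        · simp only [List.flatten_cons, occ_append]
          rw [ih b1.2 hT]
          have : occ t T0 = 0 := by
            by_contra hne
            exact h0 (b1.1 T hT t ht (Nat.pos_of_ne_zero hne))
          omega
    rcases hocc2 t ht with h | h
    · omega
    · omega
  have hncS : nc isC S2.flatten = nc isC L := by
    have key : ∀ L1 L2 : Wd τ, (∀ t, isC t = true → occ t L1 = occ t L2) → nc isC L1 = nc isC L2 := by
      intro L1 L2 h
      have e : ∀ L : Wd τ, nc isC L = ((L.map Prod.fst).filter isC).length := by
        intro L
        rw [List.filter_map]; simp [nc, Function.comp_def]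
      rw [e, e]
      apply List.Perm.length_eq
      rw [List.perm_iff_count]
      intro t
      by_cases ht : isC t = true
      · rw [List.count_filter ht, List.count_filter ht]; exact h t ht
      · rw [List.count_eq_zero.2, List.count_eq_zero.2] <;> simp [ht]
    exact key _ _ hoccC
  obtain ⟨keep, u', c1, c2, c3⟩ := reduce_all isC u hu S2 b1 hocc3
    (b5 _ u (fun T hT => (a1 T hT).2))
  have hmono := b4 (fun T hT => (a1 T hT).1)
  have hflat : ∀ S : List (Wd τ), (S.map (fun T => T.filter (fun p => keep p.1 = true))).flatten =
      S.flatten.filter (fun p => keep p.1 = true) := by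
    intro S
    rw [List.filter_flatten]
  refine ⟨S2.map (fun T => T.filter (fun p => keep p.1 = true)), u', ?_, ?_, ?_, ?_, ?_, ?_⟩
  · intro T hT
    obtain ⟨T0, hT0, rfl⟩ := List.mem_map.1 hT
    refine ⟨?_, (c2 T0 hT0).1⟩
    obtain ⟨i, hi⟩ := hmono T0 hT0
    exact ⟨i, fun p hp => hi p (List.mem_filter.1 hp).1⟩
  · intro t ht
    refine ⟨(c1 t ht).2, ?_⟩
    rw [hflat, occ_filter (fun t => keep t = true), if_pos (c1 t ht).1, hoccC t ht]
  · intro t ht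
    rw [hflat, occ_filter (fun t => keep t = true)]
    split_ifs
    · exact hocc2 t ht
    · simp
  · rw [← hncS]
    clear hflat hmono hncS hocc2 hocc3 hoccC b1 b2 b3 b4 b5 b6 c3
    induction S2 with
    | nil => simp
    | cons T S ih =>
      have := ih (fun T h => c2 T (by simp [h]))
      have h2 := (c2 T (by simp)).2
      simp only [List.map_cons, List.flatten_cons, List.length_append, nc_append]
      omega
  · rw [← hncS]; exact c3
  · intro H _ f' hf'
    have e : ∀ T : Wd τ, ev (fun t => if keep t then f' t else 1) T =
        ev f' (T.filter (fun p => keep p.1 = true)) := by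
      intro T
      rw [← ev_filter (fun t => if keep t then f' t else 1) (fun t => keep t = true) T
        (by intro t ht; simp [ht])]
      apply ev_congr
      intro p hp
      have := (List.mem_filter.1 hp).2
      simp at this
      simp [this]
    obtain ⟨f, d1, d2, d3⟩ := b6 H (fun t => if keep t then f' t else 1) (by
      intro T hT
      rw [e]
      exact hf' _ (List.mem_map.2 ⟨T, hT, rfl⟩))
    refine ⟨f, ?_, ?_⟩
    · intro t ht
      rw [d1 t (by simp [ht])]
      simp [(c1 t ht).1]
    · rw [a4 H f d2, d3, List.map_map]
      congr 1
      apply List.map_congr_left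
      intro T _
      exact e T

end Stmt3
end

section
namespace Stmt3

/-- A length function on a group. -/
structure Len {G : Type} [Group G] (l : G → ℕ) : Prop where
  one : l 1 = 0
  mul : ∀ a b, l (a * b) ≤ l a + l b
  inv : ∀ a, l a⁻¹ ≤ l a

lemma Len.ev {G τ : Type} [Group G] {l : G → ℕ} (hl : Len l) (f : τ → G) (K : ℕ) (L : Wd τ)
    (h : ∀ p ∈ L, l (f p.1) ≤ K) : l (ev f L) ≤ K * L.length := by
  induction L with
  | nil => simp [hl.one]
  | cons p L ih =>
    have h1 := ih (fun p hp => h p (by simp [hp]))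
    have h2 := h p (by simp)
    have h3 : l (tv f p) ≤ K := by
      obtain ⟨t, b⟩ := p
      cases b
      · exact (hl.inv _).trans h2
      · exact h2
    have := hl.mul (tv f p) (Stmt3.ev f L)
    simp only [ev_cons, List.length_cons]
    rw [Nat.mul_succ]
    omega

/-- Truncated Magnus group over the field with two elements. -/
@[ext] structure HG (τ : Type) where
  v : τ → ZMod 2
  m : τ → τ → ZMod 2

namespace HG
variable {τ : Type}

instance : Mul (HG τ) := ⟨fun a b => ⟨fun t => a.v t + b.v t, fun s t => a.m s t + b.m s t + a.v s * b.v t⟩⟩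
instance : One (HG τ) := ⟨⟨fun _ => 0, fun _ _ => 0⟩⟩
instance : Inv (HG τ) := ⟨fun a => ⟨a.v, fun s t => a.m s t + a.v s * a.v t⟩⟩

@[simp] lemma mul_v (a b : HG τ) (t) : (a * b).v t = a.v t + b.v t := rfl
@[simp] lemma mul_m (a b : HG τ) (s t) : (a * b).m s t = a.m s t + b.m s t + a.v s * b.v t := rfl
@[simp] lemma one_v (t) : (1 : HG τ).v t = 0 := rfl
@[simp] lemma one_m (s t) : (1 : HG τ).m s t = 0 := rfl
@[simp] lemma inv_v (a : HG τ) (t) : (a⁻¹).v t = a.v t := rfl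
@[simp] lemma inv_m (a : HG τ) (s t) : (a⁻¹).m s t = a.m s t + a.v s * a.v t := rfl

instance : Group (HG τ) := Group.ofLeftAxioms
  (by
    intro a b c
    ext s t
    · simp [add_assoc]
    · simp; ring)
  (by
    intro a
    ext s t <;> simp)
  (by
    intro a
    ext s t
    · simp [CharTwo.add_self_eq_zero]
    · simp only [mul_m, inv_m, inv_v, one_m]
      generalize a.m s t = x
      generalize a.v s = y
      generalize a.v t = z
      revert x y z
      decide)

lemma ci_of_v (a : HG τ) (h : ∀ t, a.v t = 0) : CI a := by
  constructor
  · ext s t <;> simp [h, CharTwo.add_self_eq_zero]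
  · intro b
    ext s t <;> simp [h, add_comm]

lemma sq_mul_m (x w : HG τ) (s t) : (x * x * w).m s t = x.v s * x.v t + w.m s t := by
  simp only [mul_m, mul_v]
  generalize x.m s t = a
  generalize w.m s t = b
  generalize x.v s = c
  generalize x.v t = d
  generalize w.v t = e
  revert a b c d e
  decide

lemma comm_mul_m (x y w : HG τ) (s t) : (x * y * x⁻¹ * y⁻¹ * w).m s t =
    x.v s * y.v t + y.v s * x.v t + w.m s t := by
  simp only [mul_m, mul_v, inv_m, inv_v]
  generalize x.m s t = a
  generalize w.m s t = b
  generalize x.v s = c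
  generalize x.v t = d
  generalize w.v t = e
  generalize y.m s t = a'
  generalize y.v s = c'
  generalize y.v t = d'
  have h2 : (2 : ZMod 2) = 0 := by decide
  linear_combination (a + a' + c * d + c' * d' + c * e + c' * e + c * d') * h2

end HG

section
variable {τ : Type} [DecidableEq τ]

/-- Universal assignment. -/
def hg0 (t : τ) : HG τ := ⟨fun s => if t = s then 1 else 0, fun _ _ => 0⟩

lemma hg0_v (W : Wd τ) (t : τ) : (ev hg0 W).v t = (occ t W : ZMod 2) := by
  induction W with
  | nil => simp
  | cons p W ih =>
    obtain ⟨s, b⟩ := p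
    simp only [ev_cons, HG.mul_v, ih, occ_cons]
    cases b <;> simp [tv, hg0]

lemma hg0_m (W : Wd τ) (t : τ) (h : occ t W = 0) (s : τ) :
    (ev hg0 W).m t s = 0 ∧ (ev hg0 W).m s t = 0 := by
  induction W with
  | nil => simp
  | cons p W ih =>
    obtain ⟨q, b⟩ := p
    simp only [occ_cons] at h
    have hq : q ≠ t := by rintro rfl; simp at h
    have hW : occ t W = 0 := by omega
    have := ih hW
    have hv := hg0_v W t
    rw [hW] at hv
    cases b <;> simp [tv, hg0, this, hv, hq]

lemma bool_ne {a b : Bool} (h : ¬ a = b) : a = !b := by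
  cases a <;> cases b <;> simp_all

/-- Trichotomy for nonempty quadratic words. -/
lemma step_aux (W : Wd τ) (ho : ∀ t, occ t W = 0 ∨ occ t W = 2) (n : ℕ) :
    ∀ A t ε B δ D, W = A ++ (t, ε) :: (B ++ (t, δ) :: D) → B.length = n →
    (∃ A t ε B D, W = A ++ (t, ε) :: (B ++ (t, ε) :: D)) ∨
    (∃ A a α B b β E F D,
      W = A ++ (a, α) :: (B ++ (b, β) :: (E ++ (a, !α) :: (F ++ (b, !β) :: D)))) ∨
    (∃ A t ε D, W = A ++ (t, ε) :: (t, !ε) :: D) := by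
  induction n using Nat.strong_induction_on with
  | _ n ih =>
    intro A t ε B δ D hW hB
    by_cases hδ : δ = ε
    · subst hδ; exact Or.inl ⟨A, t, δ, B, D, hW⟩
    have h' : δ = !ε := bool_ne hδ
    subst h'
    match B, hB, hW with
    | [], hB, hW => exact Or.inr (Or.inr ⟨A, t, ε, D, hW⟩)
    | (z, ζ) :: B', hB, hW =>
      have ht := ho t
      have hz := ho z
      rw [hW] at ht hz
      simp only [occ_append, occ_cons, if_true] at ht hz
      have hzt : z ≠ t := by
        rintro rfl
        simp at ht; omega
      simp only [hzt, hzt.symm, if_false] at ht hz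
      by_cases hzB : 0 < occ z B'
      · obtain ⟨B1, ζ', B2, rfl⟩ := occ_split hzB
        exact ih B1.length (by simp at hB; omega) (A ++ [(t, ε)]) z ζ B1 ζ' (B2 ++ (t, !ε) :: D)
          (by rw [hW]; simp) rfl
      by_cases hzA : 0 < occ z A
      · obtain ⟨A1, ζ', A2, rfl⟩ := occ_split hzA
        by_cases hζ : ζ = ζ'
        · subst hζ
          exact Or.inl ⟨A1, z, ζ, A2 ++ [(t, ε)], B' ++ (t, !ε) :: D, by rw [hW]; simp⟩
        · have h' : ζ = !ζ' := bool_ne hζ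
          subst h'
          exact Or.inr (Or.inl ⟨A1, z, ζ', A2, t, ε, [], B', D, by rw [hW]; simp⟩)
      · have hzD : 0 < occ z D := by omega
        obtain ⟨D1, ζ', D2, rfl⟩ := occ_split hzD
        by_cases hζ : ζ' = ζ
        · subst hζ
          exact Or.inl ⟨A ++ [(t, ε)], z, ζ', B' ++ (t, !ε) :: D1, D2, by rw [hW]; simp⟩
        · have h' : ζ' = !ζ := bool_ne hζ
          subst h'
          exact Or.inr (Or.inl ⟨A, t, ε, [], z, ζ, B', D1, D2, by rw [hW]; simp⟩)

lemma step (W : Wd τ) (hne : W ≠ []) (ho : ∀ t, occ t W = 0 ∨ occ t W = 2) :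
    (∃ A t ε B D, W = A ++ (t, ε) :: (B ++ (t, ε) :: D)) ∨
    (∃ A a α B b β E F D,
      W = A ++ (a, α) :: (B ++ (b, β) :: (E ++ (a, !α) :: (F ++ (b, !β) :: D)))) ∨
    (∃ A t ε D, W = A ++ (t, ε) :: (t, !ε) :: D) := by
  match W, hne with
  | (t, ε) :: W', _ =>
    have h1 := ho t
    simp only [occ_cons, if_true] at h1
    obtain ⟨B, δ, D, rfl⟩ := occ_split (t := t) (L := W') (by omega)
    exact step_aux _ ho _ [] t ε B δ D rfl rfl

/-- Extraction of a square: Gram data. -/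
lemma tw_gram {g : ℕ} (A : Wd τ) (t : τ) (ε : Bool) (B D : Wd τ)
    (ho : ∀ s, occ s (A ++ (t, ε) :: (B ++ (t, ε) :: D)) = 0 ∨
      occ s (A ++ (t, ε) :: (B ++ (t, ε) :: D)) = 2)
    (r : τ → Fin g → ZMod 2)
    (hr : ∀ s s', (ev hg0 (A ++ (t, ε) :: (B ++ (t, ε) :: D))).m s s' = r s ⬝ᵥ r s') :
    (∀ s, occ s (A ++ iv B ++ D) = 0 ∨ occ s (A ++ iv B ++ D) = 2) ∧ r t ⬝ᵥ r t = 1 ∧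
    (∀ s s', (ev hg0 (A ++ iv B ++ D)).m s s' =
      (r s + (r t ⬝ᵥ r s) • r t) ⬝ᵥ (r s' + (r t ⬝ᵥ r s') • r t)) := by
  have h0 := ho t
  simp only [occ_append, occ_cons, if_true] at h0
  have zA : occ t A = 0 := by omega
  have zB : occ t B = 0 := by omega
  have zD : occ t D = 0 := by omega
  set x : HG τ := ev hg0 (A ++ (t, ε) :: B ++ iv A) with hx
  have key : ev hg0 (A ++ (t, ε) :: (B ++ (t, ε) :: D)) = x * x * ev hg0 (A ++ iv B ++ D) := by
    simp only [hx, ev_append, ev_cons, ev_iv]; group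
  have xt : x.v t = 1 := by
    rw [hx, hg0_v]
    simp [zA, zB]
  have hM : ∀ s s', r s ⬝ᵥ r s' = x.v s * x.v s' + (ev hg0 (A ++ iv B ++ D)).m s s' := by
    intro s s'
    rw [← hr, key, HG.sq_mul_m]
  have hz : occ t (A ++ iv B ++ D) = 0 := by simp [zA, zB, zD]
  have hts : ∀ s, r t ⬝ᵥ r s = x.v s := by
    intro s
    rw [hM, xt, (hg0_m _ t hz s).1]; simp
  have htt : r t ⬝ᵥ r t = 1 := by rw [hts, xt]
  refine ⟨?_, htt, ?_⟩
  · intro s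
    have := ho s
    by_cases hs : t = s
    · subst hs; left; exact hz
    · simp [hs] at this ⊢; omega
  · intro s s'
    have e : (ev hg0 (A ++ iv B ++ D)).m s s' = r s ⬝ᵥ r s' + x.v s * x.v s' := by
      rw [hM]
      generalize x.v s * x.v s' = a
      generalize (ev hg0 (A ++ iv B ++ D)).m s s' = b
      revert a b; decide
    rw [e]
    simp only [add_dotProduct, dotProduct_add, smul_dotProduct, dotProduct_smul, smul_eq_mul, htt,
      dotProduct_comm (r s) (r t), hts]
    generalize x.v s = a
    generalize x.v s' = b
    generalize r s ⬝ᵥ r s' = c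
    revert a b c; decide

/-- Extraction of a commutator: Gram data. -/
lemma cm_gram {g : ℕ} (A : Wd τ) (a : τ) (α : Bool) (B : Wd τ) (b : τ) (β : Bool) (E F D : Wd τ)
    (W : Wd τ) (hW : W = A ++ (a, α) :: (B ++ (b, β) :: (E ++ (a, !α) :: (F ++ (b, !β) :: D))))
    (ho : ∀ s, occ s W = 0 ∨ occ s W = 2)
    (r : τ → Fin g → ZMod 2)
    (hr : ∀ s s', (ev hg0 W).m s s' = r s ⬝ᵥ r s') :
    (∀ s, occ s (A ++ F ++ E ++ B ++ D) = 0 ∨ occ s (A ++ F ++ E ++ B ++ D) = 2) ∧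
    r a ⬝ᵥ r a = 0 ∧ r b ⬝ᵥ r b = 0 ∧ r a ⬝ᵥ r b = 1 ∧
    (∀ s s', (ev hg0 (A ++ F ++ E ++ B ++ D)).m s s' =
      (r s + (r b ⬝ᵥ r s) • r a + (r a ⬝ᵥ r s) • r b) ⬝ᵥ
        (r s' + (r b ⬝ᵥ r s') • r a + (r a ⬝ᵥ r s') • r b)) := by
  have h0 := ho a
  have h1 := ho b
  rw [hW] at h0 h1
  simp only [occ_append, occ_cons, if_true] at h0 h1
  have hab : a ≠ b := by rintro rfl; simp at h0; omega
  simp only [hab, hab.symm, if_false] at h0 h1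
  have zaA : occ a A = 0 := by omega
  have zaB : occ a B = 0 := by omega
  have zaD : occ a D = 0 := by omega
  have zaE : occ a E = 0 := by omega
  have zaF : occ a F = 0 := by omega
  have zbA : occ b A = 0 := by omega
  have zbB : occ b B = 0 := by omega
  have zbD : occ b D = 0 := by omega
  have zbE : occ b E = 0 := by omega
  have zbF : occ b F = 0 := by omega
  set x : HG τ := ev hg0 (A ++ (a, α) :: B ++ iv (F ++ E ++ B) ++ iv A) with hx
  set y : HG τ := ev hg0 (A ++ F ++ E ++ B ++ (b, β) :: iv F ++ iv A) with hy
  have key : ev hg0 W = x * y * x⁻¹ * y⁻¹ * ev hg0 (A ++ F ++ E ++ B ++ D) := by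
    simp only [hW, hx, hy, ev_append, ev_cons, ev_iv, tv_not]; group
  have xa : x.v a = 1 := by rw [hx, hg0_v]; simp [zaA, zaB, zaE, zaF]
  have xb : x.v b = 0 := by rw [hx, hg0_v]; simp [zbA, zbB, zbE, zbF, hab]
  have ya : y.v a = 0 := by rw [hy, hg0_v]; simp [zaA, zaB, zaE, zaF, hab.symm]
  have yb : y.v b = 1 := by rw [hy, hg0_v]; simp [zbA, zbB, zbE, zbF]
  set W' := A ++ F ++ E ++ B ++ D with hW'
  have hM : ∀ s s', r s ⬝ᵥ r s' = x.v s * y.v s' + y.v s * x.v s' + (ev hg0 W').m s s' := by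
    intro s s'
    rw [← hr, key, HG.comm_mul_m]
  have hza : occ a W' = 0 := by simp [hW', zaA, zaB, zaE, zaF, zaD]
  have hzb : occ b W' = 0 := by simp [hW', zbA, zbB, zbE, zbF, zbD]
  have has : ∀ s, r a ⬝ᵥ r s = y.v s := by
    intro s
    rw [hM, xa, ya, (hg0_m _ a hza s).1]; simp
  have hbs : ∀ s, r b ⬝ᵥ r s = x.v s := by
    intro s
    rw [hM, xb, yb, (hg0_m _ b hzb s).1]; simp
  have haa : r a ⬝ᵥ r a = 0 := by rw [has, ya]
  have hbb : r b ⬝ᵥ r b = 0 := by rw [hbs, xb]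
  have hab1 : r a ⬝ᵥ r b = 1 := by rw [has, yb]
  refine ⟨?_, haa, hbb, hab1, ?_⟩
  · intro s
    have := ho s
    by_cases hs : a = s
    · subst hs; left; exact hza
    by_cases hs' : b = s
    · subst hs'; left; exact hzb
    · rw [hW] at this
      simp [hs, hs'] at this
      simp [hW']
      omega
  · intro s s'
    have e : (ev hg0 W').m s s' = r s ⬝ᵥ r s' + x.v s * y.v s' + y.v s * x.v s' := by
      rw [hM]
      generalize x.v s * y.v s' = c1
      generalize y.v s * x.v s' = c2
      generalize (ev hg0 W').m s s' = c3
      revert c1 c2 c3; decide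
    rw [e]
    simp only [add_dotProduct, dotProduct_add, smul_dotProduct, dotProduct_smul, smul_eq_mul, haa,
      hbb, hab1, dotProduct_comm (r b) (r a), dotProduct_comm (r s) (r a), dotProduct_comm (r s) (r b),
      hbs, has]
    have h2 : (2 : ZMod 2) = 0 := by decide
    linear_combination (-(x.v s * y.v s') - (y.v s * x.v s')) * h2

end

end Stmt3
end

section
namespace Stmt3

/-- Orthogonal complement of a vector. -/
def perp {g : ℕ} (c : Fin g → ZMod 2) : Submodule (ZMod 2) (Fin g → ZMod 2) where
  carrier := {w | c ⬝ᵥ w = 0}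
  add_mem' := by
    intro a b ha hb
    simp only [Set.mem_ofPred_eq] at *
    rw [dotProduct_add, ha, hb, add_zero]
  zero_mem' := by simp
  smul_mem' := by
    intro k a ha
    simp only [Set.mem_ofPred_eq] at *
    rw [dotProduct_smul, ha, smul_zero]

lemma mem_perp {g : ℕ} (c w : Fin g → ZMod 2) : w ∈ perp c ↔ c ⬝ᵥ w = 0 := Iff.rfl

lemma perp_drop {g : ℕ} (U : Submodule (ZMod 2) (Fin g → ZMod 2)) (c x : Fin g → ZMod 2)
    (hx : x ∈ U) (h : c ⬝ᵥ x = 1) :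
    Module.finrank (ZMod 2) (U ⊓ perp c : Submodule (ZMod 2) (Fin g → ZMod 2)) + 1 ≤
      Module.finrank (ZMod 2) U := by
  apply Submodule.finrank_lt_finrank_of_lt
  refine lt_of_le_of_ne inf_le_left ?_
  intro h'
  rw [← h'] at hx
  have := hx.2
  change c ⬝ᵥ x = 0 at this
  rw [h] at this
  exact absurd this (by decide)

section
variable {τ : Type} [DecidableEq τ] {G : Type} [Group G]

lemma squares {g : ℕ} {l : G → ℕ} (hl : Len l) (f : τ → G) (K n0 : ℕ) (N : ℕ) :
    ∀ (W : Wd τ), W.length = N → N ≤ n0 → (∀ p ∈ W, l (f p.1) ≤ K) →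
    (∀ t, occ t W = 0 ∨ occ t W = 2) →
    ∀ (r : τ → Fin g → ZMod 2), (∀ s s', (ev hg0 W).m s s' = r s ⬝ᵥ r s') →
    ∀ U : Submodule (ZMod 2) (Fin g → ZMod 2), (∀ t, r t ∈ U) →
    ∀ y : G, ∃ S : List G, S.length ≤ Module.finrank (ZMod 2) U + 1 ∧
      y * y * ev f W = (S.map (fun a => a * a)).prod ∧
      ∀ a ∈ S, l a ≤ 3 * l y + 10 * (K * n0) * N := by
  induction N using Nat.strong_induction_on with
  | _ N ih =>
  intro W hN hn0 hK ho r hr U hU y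
  by_cases hne : W = []
  · subst hne
    refine ⟨[y], by simp, by simp, ?_⟩
    intro a ha
    simp only [List.mem_singleton] at ha
    subst ha
    have : 0 ≤ 10 * (K * n0) * N := Nat.zero_le _
    omega
  rcases step W hne ho with ⟨A, t, ε, B, D, hW⟩ | ⟨A, a, α, B, b, β, E, F, D, hW⟩ | ⟨A, t, ε, D, hW⟩
  · obtain ⟨h1, h2, h3⟩ := tw_gram A t ε B D (hW ▸ ho) r (hW ▸ hr)
    have hlen : N = (A ++ iv B ++ D).length + 2 := by rw [← hN, hW]; simp; omega
    have hK' : ∀ p ∈ A ++ (t, ε) :: B ++ iv A, l (f p.1) ≤ K := by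
      intro p hp
      simp only [List.mem_append, List.mem_cons] at hp
      rcases hp with (hp | hp | hp) | hp
      · exact hK p (by simp [hW, hp])
      · exact hK p (by simp [hW, hp])
      · exact hK p (by simp [hW, hp])
      · obtain ⟨q, hq, e⟩ := mem_iv_fst _ _ hp
        rw [← e]; exact hK q (by simp [hW, hq])
    have hK'' : ∀ p ∈ A ++ iv B ++ D, l (f p.1) ≤ K := by
      intro p hp
      simp only [List.mem_append] at hp
      rcases hp with (hp | hp) | hp
      · exact hK p (by simp [hW, hp])
      · obtain ⟨q, hq, e⟩ := mem_iv_fst _ _ hp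
        rw [← e]; exact hK q (by simp [hW, hq])
      · exact hK p (by simp [hW, hp])
    have hx := hl.ev f K _ hK'
    set x := ev f (A ++ (t, ε) :: B ++ iv A) with hxdef
    have key : ev f W = x * x * ev f (A ++ iv B ++ D) := by
      simp only [hW, hxdef, ev_append, ev_cons, ev_iv]; group
    obtain ⟨S, s1, s2, s3⟩ := ih _ (by omega) (A ++ iv B ++ D) rfl (by omega) hK'' h1 _ h3
      (U ⊓ perp (r t)) (by
        intro s
        refine ⟨U.add_mem (hU s) (U.smul_mem _ (hU t)), ?_⟩
        change r t ⬝ᵥ _ = 0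
        rw [dotProduct_add, dotProduct_smul, h2, smul_eq_mul, mul_one, CharTwo.add_self_eq_zero]) x
    refine ⟨y :: S, ?_, ?_, ?_⟩
    · have := perp_drop U (r t) (r t) (hU t) h2
      simp; omega
    · rw [key, s2]; simp
    · intro a ha
      have hx2 : l x ≤ 2 * (K * n0) := by
        refine hx.trans ?_
        rw [show 2 * (K * n0) = K * (2 * n0) by ring]
        refine Nat.mul_le_mul_left _ ?_
        simp at hlen ⊢; omega
      rw [List.mem_cons] at ha
      rcases ha with rfl | ha
      · have : 0 ≤ 10 * (K * n0) * N := Nat.zero_le _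
        omega
      · have := s3 a ha
        rw [hlen]
        generalize (A ++ iv B ++ D).length = q at *
        nlinarith
  · obtain ⟨h1, ha0, hb0, hab, h3⟩ := cm_gram A a α B b β E F D W hW ho r hr
    have hlen : N = (A ++ F ++ E ++ B ++ D).length + 4 := by rw [← hN, hW]; simp; omega
    have hKA : ∀ p ∈ A, l (f p.1) ≤ K := fun p hp => hK p (by simp [hW, hp])
    have hKB : ∀ p ∈ B, l (f p.1) ≤ K := fun p hp => hK p (by simp [hW, hp])
    have hKE : ∀ p ∈ E, l (f p.1) ≤ K := fun p hp => hK p (by simp [hW, hp])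
    have hKF : ∀ p ∈ F, l (f p.1) ≤ K := fun p hp => hK p (by simp [hW, hp])
    have hKD : ∀ p ∈ D, l (f p.1) ≤ K := fun p hp => hK p (by simp [hW, hp])
    have hKa : l (f a) ≤ K := hK (a, α) (by simp [hW])
    have hKb : l (f b) ≤ K := hK (b, β) (by simp [hW])
    have hiv : ∀ L : Wd τ, (∀ p ∈ L, l (f p.1) ≤ K) → ∀ p ∈ iv L, l (f p.1) ≤ K := by
      intro L h p hp
      obtain ⟨q, hq, e⟩ := mem_iv_fst _ _ hp
      rw [← e]; exact h q hq
    have happ : ∀ L L' : Wd τ, (∀ p ∈ L, l (f p.1) ≤ K) → (∀ p ∈ L', l (f p.1) ≤ K) →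
        ∀ p ∈ L ++ L', l (f p.1) ≤ K := by
      intro L L' h h' p hp
      rcases List.mem_append.1 hp with hp | hp
      · exact h p hp
      · exact h' p hp
    have hcons : ∀ c (L : Wd τ), l (f c.1) ≤ K → (∀ p ∈ L, l (f p.1) ≤ K) →
        ∀ p ∈ c :: L, l (f p.1) ≤ K := by
      intro c L h h' p hp
      rcases List.mem_cons.1 hp with hp | hp
      · rw [hp]; exact h
      · exact h' p hp
    have hu := hl.ev f K (A ++ ((a, α) :: (B ++ (iv (F ++ E ++ B) ++ iv A))))
      (happ _ _ hKA (hcons _ _ hKa (happ _ _ hKB (happ _ _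
        (hiv _ (happ _ _ (happ _ _ hKF hKE) hKB)) (hiv _ hKA)))))
    have hv := hl.ev f K (A ++ F ++ E ++ B ++ (b, β) :: (iv F ++ iv A))
      (happ _ _ (happ _ _ (happ _ _ (happ _ _ hKA hKF) hKE) hKB)
        (hcons _ _ hKb (happ _ _ (hiv _ hKF) (hiv _ hKA))))
    have hK'' := happ _ _ (happ _ _ (happ _ _ (happ _ _ hKA hKF) hKE) hKB) hKD
    set u := ev f (A ++ ((a, α) :: (B ++ (iv (F ++ E ++ B) ++ iv A)))) with hudef
    set v := ev f (A ++ F ++ E ++ B ++ (b, β) :: (iv F ++ iv A)) with hvdef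
    have key : ev f W = u * v * u⁻¹ * v⁻¹ * ev f (A ++ F ++ E ++ B ++ D) := by
      simp only [hW, hudef, hvdef, ev_append, ev_cons, ev_iv, tv_not]; group
    have hba : r b ⬝ᵥ r a = 1 := by rw [dotProduct_comm]; exact hab
    obtain ⟨S, s1, s2, s3⟩ := ih _ (by omega) (A ++ F ++ E ++ B ++ D) rfl (by omega) hK'' h1 _ h3
      ((U ⊓ perp (r a)) ⊓ perp (r b)) (by
        intro s
        refine ⟨⟨U.add_mem (U.add_mem (hU s) (U.smul_mem _ (hU a))) (U.smul_mem _ (hU b)), ?_⟩, ?_⟩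
        · change r a ⬝ᵥ _ = 0
          rw [dotProduct_add, dotProduct_add, dotProduct_smul, dotProduct_smul, ha0, hab]
          simp [CharTwo.add_self_eq_zero]
        · change r b ⬝ᵥ _ = 0
          rw [dotProduct_add, dotProduct_add, dotProduct_smul, dotProduct_smul, hb0, hba]
          simp [CharTwo.add_self_eq_zero]) (y * u)
    have hu2 : l u ≤ 2 * (K * n0) := by
      refine hu.trans ?_
      rw [show 2 * (K * n0) = K * (2 * n0) by ring]
      refine Nat.mul_le_mul_left _ ?_
      simp at hlen ⊢; omega
    have hv2 : l v ≤ 2 * (K * n0) := by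
      refine hv.trans ?_
      rw [show 2 * (K * n0) = K * (2 * n0) by ring]
      refine Nat.mul_le_mul_left _ ?_
      simp at hlen ⊢; omega
    have ht := hl.mul y u
    set T := y * u with hT
    have l1 : l (T * u⁻¹ * T * v * T⁻¹) ≤ 3 * l y + 10 * (K * n0) := by
      have e1 := hl.mul (T * u⁻¹ * T * v) T⁻¹
      have e2 := hl.mul (T * u⁻¹ * T) v
      have e3 := hl.mul (T * u⁻¹) T
      have e4 := hl.mul T u⁻¹
      have e5 := hl.inv T
      have e6 := hl.inv u
      omega
    have l2 : l (T * v⁻¹ * T⁻¹ * T⁻¹) ≤ 3 * l y + 10 * (K * n0) := by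
      have e2 := hl.mul (T * v⁻¹ * T⁻¹) T⁻¹
      have e3 := hl.mul (T * v⁻¹) T⁻¹
      have e4 := hl.mul T v⁻¹
      have e5 := hl.inv T
      have e6 := hl.inv v
      omega
    have hN1 : 10 * (K * n0) ≤ 10 * (K * n0) * N := Nat.le_mul_of_pos_right _ (by omega)
    refine ⟨(T * u⁻¹ * T * v * T⁻¹) :: (T * v⁻¹ * T⁻¹ * T⁻¹) :: S, ?_, ?_, ?_⟩
    · have := perp_drop U (r a) (r b) (hU b) hab
      have := perp_drop (U ⊓ perp (r a)) (r b) (r a) ⟨hU a, ha0⟩ hba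
      simp; omega
    · simp only [List.map_cons, List.prod_cons]
      rw [← s2, key]
      simp only [hT]
      group
    · intro c hc
      simp only [List.mem_cons] at hc
      rcases hc with rfl | rfl | hc
      · omega
      · omega
      · have := s3 c hc
        rw [hlen]
        generalize (A ++ F ++ E ++ B ++ D).length = q at *
        nlinarith
  · have hev : ∀ {H : Type} [Group H] (f : τ → H), ev f W = ev f (A ++ D) := by
      intro H _ f
      simp only [hW, ev_append, ev_cons, tv_not]; group
    have h0 := ho t
    rw [hW] at h0
    simp only [occ_append, occ_cons, if_true] at h0
    obtain ⟨S, s1, s2, s3⟩ := ih (A ++ D).length (by rw [← hN, hW]; simp) (A ++ D) rfl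
      (by rw [← hN, hW] at hn0; simp at hn0 ⊢; omega)
      (by
        intro p hp
        rcases List.mem_append.1 hp with hp | hp
        · exact hK p (by simp [hW, hp])
        · exact hK p (by simp [hW, hp]))
      (by
        intro s
        by_cases hs : t = s
        · subst hs; left; simp; omega
        · have := ho s
          rw [hW] at this
          simp [hs] at this ⊢
          omega) r (by rw [← hev]; exact hr) U hU y
    refine ⟨S, s1, by rw [hev, s2], ?_⟩
    intro a ha
    refine (s3 a ha).trans ?_
    have : (A ++ D).length ≤ N := by rw [← hN, hW]; simp; omega
    have := Nat.mul_le_mul_left (10 * (K * n0)) this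
    omega

/-- Without a twisted pair the diagonal of the Gram matrix vanishes. -/
lemma diag_zero (W : Wd τ) (ho : ∀ t, occ t W = 0 ∨ occ t W = 2)
    (h : ¬ ∃ A t ε B D, W = A ++ (t, ε) :: (B ++ (t, ε) :: D)) (t : τ) :
    (ev hg0 W).m t t = 0 := by
  rcases ho t with h0 | h2
  · exact (hg0_m W t h0 t).1
  · obtain ⟨A, ε, X, rfl⟩ := occ_split (t := t) (L := W) (by omega)
    simp only [occ_append, occ_cons, if_true] at h2
    by_cases hA : 0 < occ t A
    · obtain ⟨A1, δ, A2, rfl⟩ := occ_split hA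
      by_cases hd : δ = ε
      · subst hd; exact absurd ⟨A1, t, δ, A2, X, by simp⟩ h
      have h' := bool_ne hd
      subst h'
      simp at h2
      have z1 := hg0_m A1 t (by omega) t
      have z2 := hg0_m A2 t (by omega) t
      have z3 := hg0_m X t (by omega) t
      have y1 := hg0_v A1 t
      have y2 := hg0_v A2 t
      have y3 := hg0_v X t
      rw [show occ t A1 = 0 by omega] at y1
      rw [show occ t A2 = 0 by omega] at y2
      rw [show occ t X = 0 by omega] at y3
      cases ε <;> simp [tv, hg0, z1, z2, z3, y1, y2, y3, CharTwo.add_self_eq_zero]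
    · obtain ⟨A1, δ, A2, rfl⟩ := occ_split (t := t) (L := X) (by omega)
      by_cases hd : δ = ε
      · subst hd; exact absurd ⟨A, t, δ, A1, A2, by simp⟩ h
      have h' := bool_ne hd
      subst h'
      simp at h2
      have z1 := hg0_m A1 t (by omega) t
      have z2 := hg0_m A2 t (by omega) t
      have z3 := hg0_m A t (by omega) t
      have y1 := hg0_v A1 t
      have y2 := hg0_v A2 t
      have y3 := hg0_v A t
      rw [show occ t A1 = 0 by omega] at y1
      rw [show occ t A2 = 0 by omega] at y2
      rw [show occ t A = 0 by omega] at y3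
      cases ε <;> simp [tv, hg0, z1, z2, z3, y1, y2, y3, CharTwo.add_self_eq_zero]

/-- Main squares lemma. -/
lemma squares_main {g : ℕ} (hg : 1 ≤ g) {l : G → ℕ} (hl : Len l) (f : τ → G) (K n0 : ℕ)
    (W : Wd τ) (hn0 : W.length ≤ n0) (hK : ∀ p ∈ W, l (f p.1) ≤ K)
    (ho : ∀ t, occ t W = 0 ∨ occ t W = 2)
    (r : τ → Fin g → ZMod 2) (hr : ∀ s s', (ev hg0 W).m s s' = r s ⬝ᵥ r s') :
    ∃ S : List G, S.length = g ∧ ev f W = (S.map (fun a => a * a)).prod ∧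
      ∀ a ∈ S, l a ≤ 6 * (K * n0) + 10 * (K * n0) * n0 := by
  suffices h : ∃ S : List G, S.length ≤ g ∧ ev f W = (S.map (fun a => a * a)).prod ∧
      ∀ a ∈ S, l a ≤ 6 * (K * n0) + 10 * (K * n0) * n0 by
    obtain ⟨S, h1, h2, h3⟩ := h
    refine ⟨S ++ List.replicate (g - S.length) 1, by simp; omega, by simp [h2], ?_⟩
    intro a ha
    rcases List.mem_append.1 ha with ha | ha
    · exact h3 a ha
    · rw [List.eq_of_mem_replicate ha, hl.one]; exact Nat.zero_le _
  have hfin : Module.finrank (ZMod 2) (⊤ : Submodule (ZMod 2) (Fin g → ZMod 2)) = g := by simp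
  by_cases htw : ∃ A t ε B D, W = A ++ (t, ε) :: (B ++ (t, ε) :: D)
  · obtain ⟨A, t, ε, B, D, hW⟩ := htw
    obtain ⟨h1, h2, h3⟩ := tw_gram A t ε B D (hW ▸ ho) r (hW ▸ hr)
    have hlen : W.length = (A ++ iv B ++ D).length + 2 := by rw [hW]; simp; omega
    have hK' : ∀ p ∈ A ++ (t, ε) :: B ++ iv A, l (f p.1) ≤ K := by
      intro p hp
      simp only [List.mem_append, List.mem_cons] at hp
      rcases hp with (hp | hp | hp) | hp
      · exact hK p (by simp [hW, hp])
      · exact hK p (by simp [hW, hp])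
      · exact hK p (by simp [hW, hp])
      · obtain ⟨q, hq, e⟩ := mem_iv_fst _ _ hp
        rw [← e]; exact hK q (by simp [hW, hq])
    have hK'' : ∀ p ∈ A ++ iv B ++ D, l (f p.1) ≤ K := by
      intro p hp
      simp only [List.mem_append] at hp
      rcases hp with (hp | hp) | hp
      · exact hK p (by simp [hW, hp])
      · obtain ⟨q, hq, e⟩ := mem_iv_fst _ _ hp
        rw [← e]; exact hK q (by simp [hW, hq])
      · exact hK p (by simp [hW, hp])
    have hx := hl.ev f K _ hK'
    set x := ev f (A ++ (t, ε) :: B ++ iv A) with hxdef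
    have key : ev f W = x * x * ev f (A ++ iv B ++ D) := by
      simp only [hW, hxdef, ev_append, ev_cons, ev_iv]; group
    obtain ⟨S, s1, s2, s3⟩ := squares hl f K n0 _ (A ++ iv B ++ D) rfl (by omega) hK'' h1 _ h3
      (⊤ ⊓ perp (r t)) (by
        intro s
        refine ⟨trivial, ?_⟩
        change r t ⬝ᵥ _ = 0
        rw [dotProduct_add, dotProduct_smul, h2, smul_eq_mul, mul_one, CharTwo.add_self_eq_zero]) x
    have hd := perp_drop ⊤ (r t) (r t) trivial h2
    refine ⟨S, by omega, by rw [key, s2], ?_⟩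
    intro a ha
    have hx2 : l x ≤ 2 * (K * n0) := by
      refine hx.trans ?_
      rw [show 2 * (K * n0) = K * (2 * n0) by ring]
      refine Nat.mul_le_mul_left _ ?_
      simp at hlen ⊢; omega
    have := s3 a ha
    have := Nat.mul_le_mul_left (10 * (K * n0)) (show (A ++ iv B ++ D).length ≤ n0 by omega)
    omega
  · have hd := diag_zero W ho htw
    obtain ⟨S, s1, s2, s3⟩ := squares hl f K n0 _ W rfl hn0 hK ho r hr
      (⊤ ⊓ perp (fun _ => 1)) (by
        intro s
        refine ⟨trivial, ?_⟩
        change (fun _ => 1) ⬝ᵥ r s = 0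
        have := hr s s
        rw [hd] at this
        rw [this]
        simp only [dotProduct, one_mul]
        apply Finset.sum_congr rfl
        intro i _
        generalize r s i = q
        revert q; decide) 1
    have hd := perp_drop ⊤ (fun _ => (1 : ZMod 2)) (Pi.single (⟨0, hg⟩ : Fin g) 1) trivial (by simp)
    refine ⟨S, by omega, by rw [← s2]; simp, ?_⟩
    intro a ha
    have := s3 a ha
    rw [hl.one] at this
    have := Nat.mul_le_mul_left (10 * (K * n0)) hn0
    omega

end

end Stmt3
end

section
namespace Stmt3

section
variable {τ : Type} [DecidableEq τ] {G : Type} [Group G]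

/-- Extraction of the coefficient tokens. -/
lemma extract {ι : Type} [DecidableEq ι] (big : ι → τ) (hinj : Function.Injective big)
    {l : G → ℕ} (hl : Len l) (f : τ → G) (K n0 : ℕ) (js : List ι) : js.Nodup →
    ∀ (W : Wd τ), W.length ≤ n0 → (∀ p ∈ W, l (f p.1) ≤ K) → (∀ j ∈ js, occ (big j) W = 1) →
    ∃ (w : ι → G) (ε : ι → Bool) (W' : Wd τ),
      ev f W = (js.map (fun j => w j * tv f (big j, ε j) * (w j)⁻¹)).prod * ev f W' ∧
      (∀ j, l (w j) ≤ K * n0) ∧ W'.length ≤ n0 ∧ (∀ p ∈ W', p ∈ W) ∧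
      (∀ t, (∀ j ∈ js, big j ≠ t) → occ t W' = occ t W) ∧ (∀ j ∈ js, occ (big j) W' = 0) ∧
      (∀ {H : Type} [Group H] (f' : τ → H), (∀ j ∈ js, f' (big j) = 1) → ev f' W' = ev f' W) := by
  induction js with
  | nil =>
    intro _ W hn hK _
    refine ⟨fun _ => 1, fun _ => true, W, by simp, by simp [hl.one], hn, fun p hp => hp, by simp,
      by simp, by simp⟩
  | cons j js ih =>
    intro hnd W hn hK ho
    rw [List.nodup_cons] at hnd
    obtain ⟨A, δ, D, rfl⟩ := occ_split (t := big j) (L := W) (by rw [ho j (by simp)]; exact one_pos)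
    have hj := ho j (by simp)
    simp only [occ_append, occ_cons, if_true] at hj
    have hne : ∀ j' ∈ js, big j ≠ big j' := by
      intro j' hj' h
      exact hnd.1 (hinj h ▸ hj')
    obtain ⟨w, ε, W', h1, h2, h3, h4, h5, h6, h7⟩ := ih hnd.2 (A ++ D) (by simp at hn ⊢; omega)
      (by
        intro p hp
        rcases List.mem_append.1 hp with hp | hp
        · exact hK p (by simp [hp])
        · exact hK p (by simp [hp]))
      (by
        intro j' hj'
        have := ho j' (by simp [hj'])
        simp [hne j' hj'] at this ⊢
        omega)
    refine ⟨Function.update w j (ev f A), Function.update ε j δ, W', ?_, ?_, h3, ?_, ?_, ?_, ?_⟩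
    · have e : js.map (fun j' => Function.update w j (ev f A) j' *
          tv f (big j', Function.update ε j δ j') * (Function.update w j (ev f A) j')⁻¹) =
          js.map (fun j => w j * tv f (big j, ε j) * (w j)⁻¹) := by
        apply List.map_congr_left
        intro j' hj'
        have : j' ≠ j := by rintro rfl; exact hnd.1 hj'
        simp [Function.update_of_ne this]
      rw [List.map_cons, List.prod_cons, e, mul_assoc, ← h1]
      simp only [Function.update_self, ev_append, ev_cons]
      group
    · intro j'
      by_cases hj' : j' = j
      · subst hj'
        simp only [Function.update_self]
        refine (hl.ev f K A (fun p hp => hK p (by simp [hp]))).trans (Nat.mul_le_mul_left _ ?_)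
        simp at hn; omega
      · simp [Function.update_of_ne hj', h2]
    · intro p hp
      have := h4 p hp
      simp at this ⊢
      tauto
    · intro t ht
      rw [h5 t (fun j' hj' => ht j' (by simp [hj']))]
      have := ht j (by simp)
      simp [this]
    · intro j' hj'
      rcases List.mem_cons.1 hj' with rfl | hj'
      · rw [h5 _ (fun j'' hj'' h => hne j'' hj'' h.symm)]
        simp; omega
      · exact h6 j' hj'
    · intro H _ f' hf'
      rw [h7 f' (fun j' hj' => hf' j' (by simp [hj']))]
      have := hf' j (by simp)
      cases δ <;> simp [tv, this]

/-- Correction of the signs using one square. -/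
lemma flip {ι : Type} [DecidableEq ι] {l : G → ℕ} (hl : Len l) (C w : ι → G) (ε : ι → Bool)
    (R : ℕ) (hR : ∀ j, 2 * l (w j) + l (C j) ≤ R) (js : List ι) : js.Nodup → ∀ y : G,
    ∃ (v : ι → G) (y' : G),
      y * y * (js.map (fun j => w j * cond (ε j) (C j) (C j)⁻¹ * (w j)⁻¹)).prod =
        (js.map (fun j => v j * C j * (v j)⁻¹)).prod * (y' * y') ∧
      l y' ≤ l y + R * js.length ∧ ∀ j, l (v j) ≤ 2 * (l y + R * js.length) + R := by
  induction js with
  | nil =>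
    intro _ y
    exact ⟨fun _ => 1, y, by simp, by simp, by simp [hl.one]⟩
  | cons j js ih =>
    intro hnd y
    rw [List.nodup_cons] at hnd
    suffices h : ∃ y1 v1, y * y * (w j * cond (ε j) (C j) (C j)⁻¹ * (w j)⁻¹) =
        v1 * C j * v1⁻¹ * (y1 * y1) ∧ l y1 ≤ l y + R ∧ l v1 ≤ 2 * l y + R by
      obtain ⟨y1, v1, h1, h2, h3⟩ := h
      obtain ⟨v, y', e1, e2, e3⟩ := ih hnd.2 y1
      refine ⟨Function.update v j v1, y', ?_, ?_, ?_⟩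
      · have e : js.map (fun j' => Function.update v j v1 j' * C j' * (Function.update v j v1 j')⁻¹) =
            js.map (fun j => v j * C j * (v j)⁻¹) := by
          apply List.map_congr_left
          intro j' hj'
          have : j' ≠ j := by rintro rfl; exact hnd.1 hj'
          simp [Function.update_of_ne this]
        rw [List.map_cons, List.prod_cons, List.map_cons, List.prod_cons, e, ← mul_assoc, h1,
          mul_assoc _ (y1 * y1), e1]
        simp only [Function.update_self, mul_assoc]
      · simp only [List.length_cons, Nat.mul_succ]; omega
      · intro j'
        simp only [List.length_cons, Nat.mul_succ]
        by_cases hj' : j' = j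
        · subst hj'
          simp only [Function.update_self]; omega
        · have := e3 j'
          simp only [Function.update_of_ne hj']; omega
    have hw := hR j
    cases ε j
    · refine ⟨y * (w j * (C j)⁻¹ * (w j)⁻¹), y * w j, ?_, ?_, ?_⟩
      · simp only [cond_false]; group
      · have e1 := hl.mul y (w j * (C j)⁻¹ * (w j)⁻¹)
        have e2 := hl.mul (w j * (C j)⁻¹) (w j)⁻¹
        have e3 := hl.mul (w j) (C j)⁻¹
        have e4 := hl.inv (C j)
        have e5 := hl.inv (w j)
        omega
      · have := hl.mul y (w j); omega
    · refine ⟨y, y * y * w j, ?_, by omega, ?_⟩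
      · simp only [cond_true]; group
      · have := hl.mul y y
        have := hl.mul (y * y) (w j); omega

lemma ofFn_get_cast {α β : Type} (h : α → β) (S : List α) {g : ℕ} (hS : S.length = g) :
    (List.ofFn fun i : Fin g => h (S.get (i.cast hS.symm))) = S.map h := by
  subst hS
  conv_rhs => rw [← List.ofFn_get S, List.map_ofFn]
  rfl

/-- Geometric core: a one-face word gives a short solution. -/
lemma one_face {g M : ℕ} (hg : 1 ≤ g) (big : Fin M → τ) (hinj : Function.Injective big)
    {l : G → ℕ} (hl : Len l) (f : τ → G) (K n0 : ℕ) (W : Wd τ) (hn0 : W.length ≤ n0)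
    (hK : ∀ p ∈ W, l (f p.1) ≤ K) (hbig : ∀ j, occ (big j) W = 1)
    (ho : ∀ t, (∀ j, big j ≠ t) → occ t W = 0 ∨ occ t W = 2) (hW : ev f W = 1)
    (hb : τ → HG τ) (hb1 : ∀ j, hb (big j) = 1) (hb2 : ∀ t, (∀ j, big j ≠ t) → hb t = hg0 t)
    (r : τ → Fin g → ZMod 2) (hr : ∀ s s', (ev hb W).m s s' = r s ⬝ᵥ r s') :
    ∃ (x : Fin g → G) (v : Fin M → G),
      (List.ofFn fun i => x i * x i).prod *
        (List.ofFn fun j => v j * f (big j) * (v j)⁻¹).prod = 1 ∧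
      (∀ i, l (x i) ≤ 2 * (6 * (K * n0) + 10 * (K * n0) * n0 + (2 * (K * n0) + K) * M) +
        (2 * (K * n0) + K)) ∧
      (∀ j, l (v j) ≤ 2 * (6 * (K * n0) + 10 * (K * n0) * n0 + (2 * (K * n0) + K) * M) +
        (2 * (K * n0) + K)) := by
  obtain ⟨w, ε, W', h1, h2, h3, h4, h5, h6, h7⟩ := extract big hinj hl f K n0 (List.finRange M)
    (List.nodup_finRange M) W hn0 hK (fun j _ => hbig j)
  have hbig' : ∀ p ∈ W', ∀ j, big j ≠ p.1 := by
    intro p hp j hj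
    exact occ_zero.1 (h6 j (List.mem_finRange j)) p hp hj.symm
  obtain ⟨S, s1, s2, s3⟩ := squares_main hg hl f K n0 W' h3 (fun p hp => hK p (h4 p hp))
    (by
      intro t
      by_cases ht : ∀ j, big j ≠ t
      · rw [h5 t (fun j _ => ht j)]; exact ho t ht
      · push Not at ht
        obtain ⟨j, rfl⟩ := ht
        left; exact h6 j (List.mem_finRange j)) r
    (by
      intro s s'
      rw [← hr, ← h7 hb (fun j _ => hb1 j), ev_congr]
      intro p hp
      exact (hb2 p.1 (hbig' p hp)).symm)
  rcases List.eq_nil_or_concat S with hS | ⟨S0, y, hS⟩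
  · rw [hS] at s1; simp at s1; omega
  have hl2 : ∀ j, l (f (big j)) ≤ K := by
    intro j
    obtain ⟨p, hp, e⟩ := occ_pos.1 (show 0 < occ (big j) W by rw [hbig]; exact one_pos)
    rw [← e]; exact hK p hp
  obtain ⟨v, y', e1, e2, e3⟩ := flip hl (fun j => f (big j)) w ε (2 * (K * n0) + K)
    (by intro j; have := h2 j; have := hl2 j; omega) (List.finRange M)
    (List.nodup_finRange M) y
  have ly := s3 y (by simp [hS])
  have hlen : (y' :: S0).length = g := by rw [← s1, hS]; simp
  rw [List.length_finRange] at e2 e3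
  refine ⟨fun i => (y' :: S0).get (i.cast hlen.symm), v, ?_, ?_, ?_⟩
  · have t1 : (List.ofFn fun i : Fin g => (y' :: S0).get (i.cast hlen.symm) *
        (y' :: S0).get (i.cast hlen.symm)) = (y' :: S0).map (fun a => a * a) := by
      exact ofFn_get_cast (fun a => a * a) _ hlen
    rw [t1, List.ofFn_eq_map]
    have t2 : ev f W = (List.map (fun j => w j * cond (ε j) (f (big j)) (f (big j))⁻¹ * (w j)⁻¹)
        (List.finRange M)).prod * ((S0.map (fun a => a * a)).prod * (y * y)) := by
      rw [h1, s2, hS]; simp [tv]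
    rw [hW] at t2
    simp only [List.map_cons, List.prod_cons]
    generalize (List.map (fun j => w j * cond (ε j) (f (big j)) (f (big j))⁻¹ * (w j)⁻¹)
        (List.finRange M)).prod = P at *
    generalize (List.map (fun j => v j * f (big j) * (v j)⁻¹) (List.finRange M)).prod = Q at *
    generalize (S0.map (fun a => a * a)).prod = X at *
    have t3 : X * (y * y * P) = 1 := by
      have : X * (y * y) = P⁻¹ := eq_inv_of_mul_eq_one_right t2.symm
      rw [← mul_assoc, this]; simp
    rw [e1] at t3
    have t4 : X * Q = (y' * y')⁻¹ := by
      apply eq_inv_of_mul_eq_one_left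
      rw [mul_assoc]; exact t3
    rw [mul_assoc, t4]; simp
  · intro i
    change l ((y' :: S0).get (i.cast hlen.symm)) ≤ _
    have hm := List.get_mem (y' :: S0) (i.cast hlen.symm)
    generalize (y' :: S0).get (i.cast hlen.symm) = a at hm
    rcases List.mem_cons.1 hm with rfl | hm
    · omega
    · have := s3 a (by simp [hS, hm])
      omega
  · intro j
    have := e3 j
    omega

end

end Stmt3
end

section
set_option linter.unusedSectionVars false

namespace Stmt3

lemma CI.mul {H : Type} [Group H] {a b : H} (ha : CI a) (hb : CI b) : CI (a * b) := by
  constructor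
  · calc a * b * (a * b) = a * (b * a) * b := by group
      _ = (a * a) * (b * b) := by rw [← ha.2 b]; group
      _ = 1 := by rw [ha.1, hb.1, one_mul]
  · intro h
    rw [mul_assoc, hb.2, ← mul_assoc, ha.2, mul_assoc]

lemma CI.prod {H : Type} [Group H] (S : List H) (h : ∀ a ∈ S, CI a) : CI S.prod := by
  induction S with
  | nil => simpa using CI.one
  | cons a S ih =>
    rw [List.prod_cons]
    exact (h a (by simp)).mul (ih (fun b hb => h b (by simp [hb])))

section
variable {τ : Type} [DecidableEq τ]

lemma occ_flatten (t : τ) (S : List (Wd τ)) : occ t S.flatten = (S.map (occ t)).sum := by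
  induction S with
  | nil => simp
  | cons T S ih => simp [ih]

lemma pair_occ (m : τ → Prop) (S : List (Wd τ))
    (h : S.Pairwise (fun T T' => ∀ y, m y → 0 < occ y T → occ y T' = 0)) (y : τ) (hy : m y) :
    ∀ T ∈ S, occ y T = 0 ∨ occ y T = occ y S.flatten := by
  induction S with
  | nil => simp
  | cons T0 S ih =>
    rw [List.pairwise_cons] at h
    intro T hT
    simp only [List.flatten_cons, occ_append]
    by_cases h0 : 0 < occ y T0
    · have hz : ∀ T' ∈ S, occ y T' = 0 := fun T' hT' => h.1 T' hT' y hy h0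
      rcases List.mem_cons.1 hT with rfl | hT
      · right
        have : occ y S.flatten = 0 := by
          rw [occ_flatten]
          apply List.sum_eq_zero
          intro n hn
          obtain ⟨T', hT', rfl⟩ := List.mem_map.1 hn
          exact hz T' hT'
        omega
      · left; exact hz T hT
    · rcases List.mem_cons.1 hT with rfl | hT
      · left; omega
      · have := ih h.2 T hT
        omega

/-- Embedding of words. -/
def emb {σ : Type} (M : ℕ) (L : Wd σ) : Wd (σ ⊕ Fin M) := L.map (fun p => (Sum.inl p.1, p.2))

lemma ev_emb {H : Type} [Group H] {M : ℕ} (f : τ ⊕ Fin M → H) (L : Wd τ) :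
    ev f (emb M L) = ev (fun t => f (Sum.inl t)) L := ev_map _ _ _

lemma occ_emb_inl {M : ℕ} (t : τ) (L : Wd τ) : occ (Sum.inl t) (emb M L) = occ t L := by
  induction L with
  | nil => rfl
  | cons p L ih =>
    have : emb M (p :: L) = (Sum.inl p.1, p.2) :: emb M L := rfl
    rw [this, occ_cons, occ_cons, ih]; simp

lemma occ_emb_inr {M : ℕ} (j : Fin M) (L : Wd τ) : occ (Sum.inr j) (emb M L) = 0 := by
  rw [occ_zero]
  intro p hp
  obtain ⟨q, _, rfl⟩ := List.mem_map.1 hp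
  simp

lemma emb_flatten {M : ℕ} (S : List (Wd τ)) : (S.map (emb M)).flatten = emb M S.flatten := by
  simp [emb, List.map_flatten]
  rfl

/-- Partial universal assignment. -/
def hgb (M : ℕ) : τ ⊕ Fin M → HG (τ ⊕ Fin M)
  | Sum.inl t => hg0 (Sum.inl t)
  | Sum.inr _ => 1

lemma hgb_v_inl {M : ℕ} (W : Wd (τ ⊕ Fin M)) (t : τ) :
    (ev (hgb M) W).v (Sum.inl t) = (occ (Sum.inl t) W : ZMod 2) := by
  induction W with
  | nil => simp
  | cons p W ih =>
    obtain ⟨s, b⟩ := p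
    simp only [ev_cons, HG.mul_v, ih, occ_cons]
    rcases s with s | s <;> cases b <;> simp [tv, hgb, hg0]

lemma hgb_v_inr {M : ℕ} (W : Wd (τ ⊕ Fin M)) (j : Fin M) :
    (ev (hgb M) W).v (Sum.inr j) = 0 := by
  induction W with
  | nil => simp
  | cons p W ih =>
    obtain ⟨s, b⟩ := p
    simp only [ev_cons, HG.mul_v, ih]
    rcases s with s | s <;> cases b <;> simp [tv, hgb, hg0]

lemma sq_prod_m {σ : Type} (S : List (HG σ)) (s t : σ) :
    ((S.map (fun a => a * a)).prod).m s t = (S.map (fun a => a.v s * a.v t)).sum := by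
  induction S with
  | nil => simp
  | cons a S ih => rw [List.map_cons, List.prod_cons, HG.sq_mul_m, ih]; simp

end

section
variable {τ : Type} [DecidableEq τ] {G : Type} [Group G]

lemma stage2 {g M : ℕ} (hg : 1 ≤ g) {l : G → ℕ} (hl : Len l) (isC : τ → Bool)
    (xw : Fin g → Wd τ) (zw cw : Fin M → Wd τ)
    (hcw : ∀ j, ∀ p ∈ cw j, isC p.1 = true)
    (hcocc : ∀ t, isC t = true → ∑ j, occ t (cw j) = 1)
    (S : List (Wd τ)) (hSC : ∀ t, isC t = true → occ t S.flatten = 1)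
    (hSq : ∀ t, isC t = false → occ t S.flatten = 0 ∨ occ t S.flatten = 2)
    (hent : ∀ (H : Type) [Group H] (f' : τ → H), (∀ T ∈ S, CI (ev f' T)) →
        ∃ f : τ → H, (∀ t, isC t = true → f t = f' t) ∧
          (List.ofFn fun i => ev f (xw i) * ev f (xw i)).prod *
          (List.ofFn fun j => (ev f (zw j))⁻¹ * ev f (cw j) * ev f (zw j)).prod =
            (S.map (ev f')).prod)
    (f0 : τ → G) (hS1 : ∀ T ∈ S, ev f0 T = 1) (K n0 : ℕ)
    (hK : ∀ t, l (f0 t) ≤ K) (hKC : ∀ j, l (ev f0 (cw j)) ≤ K)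
    (hn0 : S.flatten.length + (∑ j, (cw j).length) + M ≤ n0) :
    ∃ (x : Fin g → G) (v : Fin M → G),
      (List.ofFn fun i => x i * x i).prod *
        (List.ofFn fun j => v j * ev f0 (cw j) * (v j)⁻¹).prod = 1 ∧
      (∀ i, l (x i) ≤ 2 * (6 * (K * n0) + 10 * (K * n0) * n0 + (2 * (K * n0) + K) * M) +
        (2 * (K * n0) + K)) ∧
      (∀ j, l (v j) ≤ 2 * (6 * (K * n0) + 10 * (K * n0) * n0 + (2 * (K * n0) + K) * M) +
        (2 * (K * n0) + K)) := by
  set DD : Fin M → Wd (τ ⊕ Fin M) := fun j => emb M (cw j) ++ [(Sum.inr j, false)] with hDD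
  set S1 : List (Wd (τ ⊕ Fin M)) := S.map (emb M) ++ List.ofFn DD with hS1def
  have hflat : S1.flatten = emb M S.flatten ++ (List.ofFn DD).flatten := by
    rw [hS1def, List.flatten_append, emb_flatten]
  have occl : ∀ t, occ (Sum.inl t) S1.flatten = occ t S.flatten + ∑ j, occ t (cw j) := by
    intro t
    rw [hflat, occ_append, occ_emb_inl, occ_flatten (Sum.inl t), List.map_ofFn, List.sum_ofFn]
    simp [hDD, occ_emb_inl]
  have occr : ∀ j, occ (Sum.inr j) S1.flatten = 1 := by
    intro j
    rw [hflat, occ_append, occ_emb_inr, occ_flatten, List.map_ofFn, List.sum_ofFn]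
    simp [hDD, occ_emb_inr]
  have hnoC : ∀ t, isC t = false → ∑ j, occ t (cw j) = 0 := by
    intro t ht
    apply Finset.sum_eq_zero
    intro j _
    rw [occ_zero]
    rintro p hp rfl
    rw [hcw j p hp] at ht
    exact absurd ht (by decide)
  have occl2 : ∀ t, occ (Sum.inl t) S1.flatten = 0 ∨ occ (Sum.inl t) S1.flatten = 2 := by
    intro t
    rw [occl]
    cases ht : isC t
    · rw [hnoC t ht]
      simpa using hSq t ht
    · rw [hSC t ht, hcocc t ht]; right; rfl
  obtain ⟨S2, b1, b2, b3, -, b5, b6⟩ := merge (fun t : τ ⊕ Fin M => ∃ s, t = Sum.inl s)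
    (fun _ => ()) _ S1 rfl (by
      rintro y ⟨s, rfl⟩
      rcases occl2 s with h | h <;> omega)
  set F : τ ⊕ Fin M → G := Sum.elim f0 (fun j => ev f0 (cw j)) with hF
  have hFinl : ∀ L : Wd τ, ev F (emb M L) = ev f0 L := fun L => ev_emb F L
  have hW1 : ∀ T ∈ S2, ev F T = 1 := by
    apply b5 G F
    intro T hT
    rw [hS1def, List.mem_append] at hT
    rcases hT with hT | hT
    · obtain ⟨T', hT', rfl⟩ := List.mem_map.1 hT
      rw [hFinl]; exact hS1 T' hT'
    · obtain ⟨j, rfl⟩ := List.mem_ofFn.1 hT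
      have hj : F (Sum.inr j) = ev f0 (cw j) := rfl
      simp only [hDD, ev_append, hFinl, ev_cons, ev_nil, tv, hj]
      simp
  have hocc2 : ∀ t, occ (Sum.inl t) S2.flatten = 0 ∨ occ (Sum.inl t) S2.flatten = 2 := by
    intro t
    rcases b2 (Sum.inl t) with h | h
    · rw [h]; exact occl2 t
    · left; exact h.2
  have hocc3 : ∀ j, occ (Sum.inr j) S2.flatten = 1 := by
    intro j
    rcases b2 (Sum.inr j) with h | ⟨⟨s, h⟩, _⟩
    · rw [h]; exact occr j
    · simp at h
  obtain ⟨f, f1, f2, f3⟩ := b6 (HG (τ ⊕ Fin M)) (hgb M) (by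
    intro T hT
    apply HG.ci_of_v
    rintro (t | j)
    · rw [hgb_v_inl]
      have h := pair_occ _ S2 b1 (Sum.inl t) ⟨t, rfl⟩ T hT
      have h' := hocc2 t
      have : occ (Sum.inl t) T = 0 ∨ occ (Sum.inl t) T = 2 := by omega
      rcases this with h | h <;> rw [h] <;> decide
    · exact hgb_v_inr _ _)
  obtain ⟨f4, h4, h5⟩ := hent (HG (τ ⊕ Fin M)) (fun t => f (Sum.inl t)) (by
    intro T hT
    rw [← ev_emb]
    exact f2 _ (by rw [hS1def]; exact List.mem_append_left _ (List.mem_map_of_mem hT)))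
  have hk : ∀ j, ev f4 (cw j) = ev f (DD j) := by
    intro j
    have : f (Sum.inr j) = 1 := f1 (Sum.inr j) (by simp)
    simp only [hDD, ev_append, ev_emb, ev_cons, ev_nil, tv, this]
    simp only [cond_false, inv_one, mul_one]
    apply ev_congr
    intro p hp
    exact h4 _ (hcw j p hp)
  have hkCI : ∀ j, CI (ev f (DD j)) := by
    intro j
    apply f2
    rw [hS1def]
    exact List.mem_append_right _ (List.mem_ofFn.2 ⟨j, rfl⟩)
  have hW : ev (hgb M) S2.flatten =
      ((List.ofFn fun i => ev f4 (xw i)).map (fun a => a * a)).prod := by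
    have e1 : ∀ j, (ev f4 (zw j))⁻¹ * ev f4 (cw j) * ev f4 (zw j) = ev f (DD j) := by
      intro j
      rw [hk, mul_assoc, (hkCI j).2]; group
    simp only [e1] at h5
    have e2 : S.map (ev fun t => f (Sum.inl t)) = (S.map (emb M)).map (ev f) := by
      rw [List.map_map]
      apply List.map_congr_left
      intro T _
      exact (ev_emb f T).symm
    rw [ev_flatten, ← f3, hS1def, List.map_append, List.prod_append, ← e2, ← h5, List.map_ofFn,
      List.map_ofFn]
    have hc : CI (List.ofFn fun j => ev f (DD j)).prod := by
      apply CI.prod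
      intro a ha
      obtain ⟨j, rfl⟩ := List.mem_ofFn.1 ha
      exact hkCI j
    have e3 : (List.ofFn (ev f ∘ DD)) = List.ofFn fun j => ev f (DD j) := rfl
    rw [e3, mul_assoc, hc.1, mul_one]
    rfl
  obtain ⟨x, v, hx, hxl, hvl⟩ := one_face hg (fun j : Fin M => (Sum.inr j : τ ⊕ Fin M))
    Sum.inr_injective hl F K n0 S2.flatten
    (by
      refine b3.trans (le_trans ?_ hn0)
      rw [hflat, List.length_append, List.length_flatten (L := List.ofFn DD), List.map_ofFn,
        List.sum_ofFn]
      have e1 : ∀ L : Wd τ, (emb M L).length = L.length := fun L => by simp [emb]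
      have e2 : (∑ i, (List.length ∘ DD) i) = ∑ j, ((cw j).length + 1) := by
        apply Finset.sum_congr rfl
        intro j _
        simp [hDD, e1]
      rw [e1, e2, Finset.sum_add_distrib]
      simp only [Finset.sum_const, Finset.card_univ, Fintype.card_fin, smul_eq_mul, mul_one]
      omega)
    (by
      rintro ⟨t | j, b⟩ _
      · exact hK t
      · exact hKC j) hocc3
    (by
      rintro (t | j) h
      · exact hocc2 t
      · exact absurd rfl (h j))
    (by
      rw [ev_flatten]
      apply List.prod_eq_one
      intro a ha
      obtain ⟨T, hT, rfl⟩ := List.mem_map.1 ha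
      exact hW1 T hT)
    (hgb M) (fun j => rfl)
    (by
      rintro (t | j) h
      · rfl
      · exact absurd rfl (h j))
    (fun t i => (ev f4 (xw i)).v t)
    (by
      intro s s'
      rw [hW, sq_prod_m, List.map_ofFn, List.sum_ofFn]
      rfl)
  exact ⟨x, v, hx, hxl, hvl⟩

end

end Stmt3
end

section
set_option linter.unusedSectionVars false

namespace Stmt3

section
variable {α B : Type} [DecidableEq α]

/-- Letter tokens of a family of words. -/
abbrev Tok (w : α → Wd B) : Type := Σ a : α, Fin (w a).length

/-- The letter of a token. -/
def lt (w : α → Wd B) (t : Tok w) : B × Bool := (w t.1).get t.2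

/-- The word of tokens of a base variable. -/
def expw (w : α → Wd B) (a : α) : Wd (Tok w) :=
  (List.finRange (w a).length).map (fun k => ((⟨a, k⟩ : Tok w), true))

lemma expw_length (w : α → Wd B) (a : α) : (expw w a).length = (w a).length := by simp [expw]

lemma mem_expw (w : α → Wd B) (a : α) (p) (hp : p ∈ expw w a) : p.1.1 = a := by
  obtain ⟨k, _, rfl⟩ := List.mem_map.1 hp
  rfl

lemma ev_expw {H : Type} [Group H] (w : α → Wd B) (F : Tok w → H) (φ : B → H) (a : α)
    (h : ∀ k, F ⟨a, k⟩ = tv φ (lt w ⟨a, k⟩)) : ev F (expw w a) = ev φ (w a) := by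
  unfold ev expw
  congr 1
  rw [List.map_map]
  conv_rhs => rw [← List.ofFn_get (w a), List.map_ofFn, List.ofFn_eq_map]
  apply List.map_congr_left
  intro k _
  simp only [Function.comp, tv, cond_true]
  rw [h]
  rfl

lemma occ_expw (w : α → Wd B) (t : Tok w) (a : α) :
    occ t (expw w a) = if t.1 = a then 1 else 0 := by
  split_ifs with h
  · subst h
    unfold occ expw
    rw [List.map_map]
    apply List.count_eq_one_of_mem
    · apply List.Nodup.map _ (List.nodup_finRange _)
      intro i j hij
      simpa using hij
    · rw [List.mem_map]
      exact ⟨t.2, List.mem_finRange _, rfl⟩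
  · rw [occ_zero]
    rintro p hp rfl
    exact h (mem_expw w a p hp)

end

lemma nc_flatten {τ : Type} (isC : τ → Bool) (S : List (Wd τ)) :
    nc isC S.flatten = (S.map (nc isC)).sum := by
  induction S with
  | nil => simp
  | cons T S ih => simp [ih]

lemma nc_iv {τ : Type} (isC : τ → Bool) (L : Wd τ) : nc isC (iv L) = nc isC L := by
  induction L with
  | nil => rfl
  | cons p L ih =>
    have : iv (p :: L) = iv L ++ [(p.1, !p.2)] := by simp [iv]
    rw [this, nc_append, ih, nc_cons, nc_cons]
    simp [add_comm]

lemma nc_all {τ : Type} (isC : τ → Bool) (L : Wd τ) (h : ∀ p ∈ L, isC p.1 = true) :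
    nc isC L = L.length := by
  unfold nc
  rw [List.filter_eq_self.2]
  simpa using h

lemma nc_none {τ : Type} (isC : τ → Bool) (L : Wd τ) (h : ∀ p ∈ L, isC p.1 = false) :
    nc isC L = 0 := by
  unfold nc
  rw [List.length_eq_zero_iff, List.filter_eq_nil_iff]
  intro p hp
  simp [h p hp]

lemma core {B ι G : Type} [DecidableEq ι] [Group G] (gen : B → G) {l : G → ℕ} (hl : Len l)
    (hgen : ∀ b, l (gen b) ≤ 1) (κB : B → ι) (θ : ι → Multiplicative (B →₀ ℤ) →* G)
    (hθ : ∀ b, θ (κB b) (Multiplicative.ofAdd (Finsupp.single b 1)) = gen b) (Q : ℕ)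
    (hθl : ∀ i a (n : ℕ), (∀ b, |(Multiplicative.toAdd a) b| ≤ (n : ℤ)) → l (θ i a) ≤ Q * n)
    (Ψ : G →* Monoid.CoprodI (fun _ : ι => Multiplicative (B →₀ ℤ)))
    (hΨ : ∀ b, Ψ (gen b) = Monoid.CoprodI.of (M := fun _ : ι => Multiplicative (B →₀ ℤ))
      (i := κB b) (Multiplicative.ofAdd (Finsupp.single b 1)))
    {g M : ℕ} (hg : 1 ≤ g) (w : Fin g ⊕ Fin M ⊕ Fin M → Wd B)
    (hw : (List.ofFn fun i => ev gen (w (Sum.inl i)) * ev gen (w (Sum.inl i))).prod *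
      (List.ofFn fun j => (ev gen (w (Sum.inr (Sum.inl j))))⁻¹ * ev gen (w (Sum.inr (Sum.inr j))) *
        ev gen (w (Sum.inr (Sum.inl j)))).prod = 1) (c K n0 : ℕ)
    (hc : c = ∑ j, (w (Sum.inr (Sum.inr j))).length) (hK : K = (Q + 1) * c + 1)
    (hn0 : n0 = 4 * c + M) :
    ∃ (x : Fin g → G) (v : Fin M → G),
      (List.ofFn fun i => x i * x i).prod *
        (List.ofFn fun j => v j * ev gen (w (Sum.inr (Sum.inr j))) * (v j)⁻¹).prod = 1 ∧
      (∀ i, l (x i) ≤ 2 * (6 * (K * n0) + 10 * (K * n0) * n0 + (2 * (K * n0) + K) * M) +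
        (2 * (K * n0) + K)) ∧
      (∀ j, l (v j) ≤ 2 * (6 * (K * n0) + 10 * (K * n0) * n0 + (2 * (K * n0) + K) * M) +
        (2 * (K * n0) + K)) := by
  classical
  set isC : Tok w → Bool := fun t => match t.1 with
    | Sum.inr (Sum.inr _) => true
    | _ => false with hisC
  set κ : Tok w → ι := fun t => κB (lt w t).1 with hκ
  set u : Tok w → Multiplicative (B →₀ ℤ) := fun t =>
    tv (fun b => Multiplicative.ofAdd (Finsupp.single b (1 : ℤ))) (lt w t) with hu
  set xw : Fin g → Wd (Tok w) := fun i => expw w (Sum.inl i) with hxw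
  set zw : Fin M → Wd (Tok w) := fun j => expw w (Sum.inr (Sum.inl j)) with hzw
  set cw : Fin M → Wd (Tok w) := fun j => expw w (Sum.inr (Sum.inr j)) with hcw
  set L : Wd (Tok w) := (List.ofFn fun i => xw i ++ xw i).flatten ++
    (List.ofFn fun j => iv (zw j) ++ cw j ++ zw j).flatten with hLdef
  have evL : ∀ {H : Type} [Group H] (f : Tok w → H), ev f L =
      (List.ofFn fun i => ev f (xw i) * ev f (xw i)).prod *
          (List.ofFn fun j => (ev f (zw j))⁻¹ * ev f (cw j) * ev f (zw j)).prod := by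
    intro H _ f
    rw [hLdef, ev_append, ev_flatten, ev_flatten, List.map_ofFn, List.map_ofFn]
    congr 3
    · funext i; simp
    · funext j; simp [mul_assoc]
  have occL : ∀ t, occ t L = (∑ i, (occ t (xw i) + occ t (xw i))) +
      ∑ j, (occ t (zw j) + occ t (cw j) + occ t (zw j)) := by
    intro t
    rw [hLdef, occ_append, occ_flatten, occ_flatten, List.map_ofFn, List.map_ofFn, List.sum_ofFn,
      List.sum_ofFn]
    simp [add_assoc]
  have ncL : nc isC L = c := by
    rw [hLdef, nc_append, nc_flatten, nc_flatten, List.map_ofFn, List.map_ofFn, List.sum_ofFn,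
      List.sum_ofFn, hc]
    have e1 : ∀ i, nc isC (xw i) = 0 := by
      intro i
      apply nc_none
      rintro ⟨t, b⟩ hp
      have := mem_expw w _ _ hp
      simp only at this
      simp [hisC, this]
    have e2 : ∀ i, nc isC (zw i) = 0 := by
      intro i
      apply nc_none
      rintro ⟨t, b⟩ hp
      have := mem_expw w _ _ hp
      simp only at this
      simp [hisC, this]
    have e3 : ∀ i, nc isC (cw i) = (w (Sum.inr (Sum.inr i))).length := by
      intro i
      rw [nc_all, expw_length]
      rintro ⟨t, b⟩ hp
      have := mem_expw w _ _ hp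
      simp only at this
      simp [hisC, this]
    simp [e1, e2, e3, nc_iv]
  obtain ⟨S, u', s1, s2, s3, s4, s5, s6⟩ := lemmaA isC κ u
    (by
      intro t _ b
      simp only [hu, tv]
      cases (lt w t).2
      · simp only [cond_false, toAdd_inv, toAdd_ofAdd, Finsupp.neg_apply, abs_neg]
        rw [Finsupp.single_apply]; split_ifs <;> simp
      · simp only [cond_true, toAdd_ofAdd]
        rw [Finsupp.single_apply]; split_ifs <;> simp) L
    (by
      have key : ∀ a, ev (fun t => Monoid.CoprodI.of (M := fun _ : ι => Multiplicative (B →₀ ℤ))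
          (i := κ t) (u t)) (expw w a) = Ψ (ev gen (w a)) := by
        intro a
        rw [ev_hom]
        apply ev_expw
        intro k
        simp only [hu, hκ, tv, hΨ]
        cases (lt w ⟨a, k⟩).2 <;> simp
      rw [evL]
      simp only [hxw, hzw, hcw, key]
      have := congrArg Ψ hw
      rw [map_mul, map_list_prod, map_list_prod, List.map_ofFn, List.map_ofFn, map_one] at this
      rw [← this]
      congr 3
      · funext i; simp
      · funext j; simp)
    (by
      rintro ⟨a, k⟩ ht
      rw [occL]
      simp only [hxw, hzw, hcw, occ_expw]
      rcases a with i | j | j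
      · simp [Finset.sum_add_distrib]
      · simp [Finset.sum_add_distrib]
      · simp [hisC] at ht)
  rw [ncL] at s4 s5
  set f0 : Tok w → G := fun t => θ (κ t) (u' t) with hf0
  have hθu : ∀ t, θ (κ t) (u t) = tv gen (lt w t) := by
    intro t
    simp only [hκ, hu, tv]
    cases (lt w t).2 <;> simp [hθ]
  have hcwC : ∀ j, ∀ p ∈ cw j, isC p.1 = true := by
    rintro j ⟨t, b⟩ hp
    have := mem_expw w _ _ hp
    simp only at this
    simp [hisC, this]
  have hval : ∀ j, ev f0 (cw j) = ev gen (w (Sum.inr (Sum.inr j))) := by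
    intro j
    apply ev_expw
    intro k
    simp only [hf0]
    rw [(s2 _ (by simp [hisC])).1, hθu]
  have hcpos : ∀ t, isC t = true → 1 ≤ c := by
    rintro ⟨a, k⟩ ht
    rcases a with i | j | j
    · simp [hisC] at ht
    · simp [hisC] at ht
    · have h1 := k.2
      have h2 := Finset.single_le_sum (f := fun j => (w (Sum.inr (Sum.inr j))).length)
        (fun i _ => Nat.zero_le _) (Finset.mem_univ j)
      omega
  have res := stage2 hg hl isC xw zw cw hcwC
    (by
      rintro ⟨a, k⟩ ht
      simp only [hcw, occ_expw]
      rcases a with i | j | j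
      · simp [hisC] at ht
      · simp [hisC] at ht
      · simp)
    S
    (by
      rintro ⟨a, k⟩ ht
      rw [(s2 _ ht).2, occL]
      simp only [hxw, hzw, hcw, occ_expw]
      rcases a with i | j | j
      · simp [hisC] at ht
      · simp [hisC] at ht
      · simp)
    s3
    (by
      intro H _ f' h
      obtain ⟨f, h1, h2⟩ := s6 H f' h
      exact ⟨f, h1, by rw [← evL, h2]⟩)
    f0
    (by
      intro T hT
      obtain ⟨⟨i, hi⟩, h2⟩ := s1 T hT
      have : ev f0 T = θ i (ev u' T) := by
        rw [ev_hom]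
        apply ev_congr
        intro p hp
        simp only [hf0, hi p hp]
      rw [this, h2, map_one])
    K n0
    (by
      intro t
      cases ht : isC t
      · have := hθl (κ t) (u' t) c (s5 t ht)
        simp only [hf0]
        nlinarith
      · simp only [hf0]
        rw [(s2 t ht).1, hθu]
        have : l (tv gen (lt w t)) ≤ 1 := by
          unfold tv
          cases (lt w t).2
          · exact (hl.inv _).trans (hgen _)
          · exact hgen _
        have : 0 ≤ (Q + 1) * c := Nat.zero_le _
        omega)
    (by
      intro j
      rw [hval]
      have h1 := hl.ev gen 1 (w (Sum.inr (Sum.inr j))) (fun p _ => hgen _)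
      have h2 := Finset.single_le_sum (f := fun j => (w (Sum.inr (Sum.inr j))).length)
        (fun i _ => Nat.zero_le _) (Finset.mem_univ j)
      rw [← hc] at h2
      nlinarith)
    (by
      have : ∑ j, (cw j).length = c := by
        rw [hc]
        exact Finset.sum_congr rfl (fun j _ => expw_length w _)
      omega)
  simpa only [hval] using res

end Stmt3
end

namespace Stmt3



section
variable (r k : ℕ) (ranks : Fin k → ℕ)

/-- Elements represented by words, as a subgroup. -/
noncomputable def reach : Subgroup (G r k ranks) where
  carrier := {x | ∃ W : Wd (B r k ranks), ev (gen r k ranks) W = x}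
  one_mem' := ⟨[], rfl⟩
  mul_mem' := by
    rintro _ _ ⟨W, rfl⟩ ⟨W', rfl⟩
    exact ⟨W ++ W', ev_append _ _ _⟩
  inv_mem' := by
    rintro _ ⟨W, rfl⟩
    exact ⟨iv W, ev_iv _ _⟩

lemma gen_mem (b : B r k ranks) : gen r k ranks b ∈ reach r k ranks :=
  ⟨[(b, true)], by simp [tv]⟩

/-- Inclusion of the free factor. -/
noncomputable def incF : FreeGroup (Fin r) →* G r k ranks :=
  (Monoid.CoprodI.of (M := Fam r k ranks) (i := none) : Fam r k ranks none →* G r k ranks)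

/-- Inclusion of an abelian factor. -/
noncomputable def incA (i : Fin k) : Multiplicative (Fin (ranks i) →₀ ℤ) →* G r k ranks :=
  (Monoid.CoprodI.of (M := Fam r k ranks) (i := some i) : Fam r k ranks (some i) →* G r k ranks)

lemma incF_of (j : Fin r) : incF r k ranks (FreeGroup.of j) = gen r k ranks (Sum.inl j) := rfl

lemma incA_of (i : Fin k) (j : Fin (ranks i)) :
    incA r k ranks i (Multiplicative.ofAdd (Finsupp.single j (1 : ℤ))) =
      gen r k ranks (Sum.inr ⟨i, j⟩) := rfl

lemma finsupp_prod {m : ℕ} {H : Type} [Group H] (φ : Multiplicative (Fin m →₀ ℤ) →* H)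
    (v : Multiplicative (Fin m →₀ ℤ)) :
    φ v = ((List.finRange m).map (fun j =>
      φ (Multiplicative.ofAdd (Finsupp.single j (1 : ℤ))) ^ (Multiplicative.toAdd v j))).prod := by
  have h : v = ((List.finRange m).map (fun j =>
      (Multiplicative.ofAdd (Finsupp.single j (1 : ℤ))) ^ (Multiplicative.toAdd v j))).prod := by
    have e : Multiplicative.toAdd v = ∑ j, (Multiplicative.toAdd v j) • Finsupp.single j (1 : ℤ) := by
      ext a
      simp [Finsupp.single_apply]
    rw [← List.ofFn_eq_map, List.prod_ofFn]
    apply Multiplicative.toAdd.injective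
    rw [toAdd_prod]
    simpa only [toAdd_zpow, toAdd_ofAdd] using e
  conv_lhs => rw [h]
  rw [map_list_prod, List.map_map]
  congr 1
  apply List.map_congr_left
  intro j _
  simp

lemma incA_mem (i : Fin k) (m : Multiplicative (Fin (ranks i) →₀ ℤ)) :
    incA r k ranks i m ∈ reach r k ranks := by
  rw [finsupp_prod]
  apply Subgroup.list_prod_mem
  intro y hy
  obtain ⟨j, _, rfl⟩ := List.mem_map.1 hy
  exact Subgroup.zpow_mem _ (gen_mem r k ranks (Sum.inr ⟨i, j⟩)) _

lemma reach_all (x : G r k ranks) : x ∈ reach r k ranks := by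
  induction x using Monoid.CoprodI.induction_on with
  | one => exact Subgroup.one_mem _
  | of i m =>
    cases i with
    | none =>
      change incF r k ranks m ∈ _
      refine FreeGroup.induction_on (C := fun m => incF r k ranks m ∈ reach r k ranks) m ?_ ?_ ?_ ?_
      · rw [map_one]; exact Subgroup.one_mem _
      · intro j; exact gen_mem r k ranks (Sum.inl j)
      · intro j h; rw [map_inv]; exact Subgroup.inv_mem _ h
      · intro x y hx hy; rw [map_mul]; exact Subgroup.mul_mem _ hx hy
    | some i =>
      change incA r k ranks i m ∈ _
      exact incA_mem r k ranks i m
  | mul x y hx hy => exact Subgroup.mul_mem _ hx hy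

lemma word_iff (x : G r k ranks) (n : ℕ) : (∃ l : List (G r k ranks), l.length = n ∧
    (∀ y ∈ l, ∃ b, y = gen r k ranks b ∨ y = (gen r k ranks b)⁻¹) ∧ l.prod = x) ↔
    ∃ W : Wd (B r k ranks), W.length = n ∧ ev (gen r k ranks) W = x := by
  constructor
  · rintro ⟨l, rfl, h, rfl⟩
    induction l with
    | nil => exact ⟨[], rfl, rfl⟩
    | cons y l ih =>
      obtain ⟨W, h1, h2⟩ := ih (fun y hy => h y (by simp [hy]))
      obtain ⟨b, hb | hb⟩ := h y (by simp)
      · exact ⟨(b, true) :: W, by simp [h1], by simp [h2, tv, hb]⟩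
      · exact ⟨(b, false) :: W, by simp [h1], by simp [h2, tv, hb]⟩
  · rintro ⟨W, rfl, rfl⟩
    refine ⟨W.map (tv (gen r k ranks)), by simp, ?_, rfl⟩
    intro y hy
    obtain ⟨⟨b, c⟩, _, rfl⟩ := List.mem_map.1 hy
    refine ⟨b, ?_⟩
    cases c
    · right; rfl
    · left; rfl

lemma wl_le (W : Wd (B r k ranks)) : wl r k ranks (ev (gen r k ranks) W) ≤ W.length :=
  Nat.sInf_le ((word_iff r k ranks _ _).2 ⟨W, rfl, rfl⟩)

lemma wl_word (x : G r k ranks) :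
    ∃ W : Wd (B r k ranks), W.length = wl r k ranks x ∧ ev (gen r k ranks) W = x := by
  apply (word_iff r k ranks _ _).1
  have : {n | ∃ l : List (G r k ranks), l.length = n ∧
    (∀ y ∈ l, ∃ b, y = gen r k ranks b ∨ y = (gen r k ranks b)⁻¹) ∧ l.prod = x}.Nonempty := by
    obtain ⟨W, h⟩ := reach_all r k ranks x
    exact ⟨W.length, (word_iff r k ranks _ _).2 ⟨W, rfl, h⟩⟩
  exact Nat.sInf_mem this

lemma wl_len : Len (wl r k ranks) where
  one := Nat.le_zero.1 (wl_le r k ranks [])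
  mul := by
    intro a b
    obtain ⟨W, h1, h2⟩ := wl_word r k ranks a
    obtain ⟨W', h1', h2'⟩ := wl_word r k ranks b
    have := wl_le r k ranks (W ++ W')
    rw [ev_append, h2, h2', List.length_append, h1, h1'] at this
    exact this
  inv := by
    intro a
    obtain ⟨W, h1, h2⟩ := wl_word r k ranks a
    have := wl_le r k ranks (iv W)
    rw [ev_iv, h2, iv_length, h1] at this
    exact this

lemma wl_gen (b : B r k ranks) : wl r k ranks (gen r k ranks b) ≤ 1 := by
  have := wl_le r k ranks [(b, true)]
  simpa [tv] using this

end

lemma Len.pow {H : Type} [Group H] {l : H → ℕ} (hl : Len l) (a : H) (n : ℕ) :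
    l (a ^ n) ≤ n * l a := by
  induction n with
  | zero => simp [hl.one]
  | succ n ih =>
    rw [pow_succ]
    have := hl.mul (a ^ n) a
    rw [Nat.succ_mul]; omega

lemma Len.zpow {H : Type} [Group H] {l : H → ℕ} (hl : Len l) (a : H) (ha : l a ≤ 1) (z : ℤ) (n : ℕ)
    (hz : |z| ≤ (n : ℤ)) : l (a ^ z) ≤ n := by
  have key : ∀ q : ℕ, q ≤ n → l (a ^ q) ≤ n := by
    intro q hq
    have := hl.pow a q
    nlinarith
  rcases Int.eq_nat_or_neg z with ⟨q, rfl | rfl⟩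
  · rw [zpow_natCast]
    apply key
    simpa using hz
  · rw [zpow_neg, zpow_natCast]
    refine (hl.inv _).trans (key q ?_)
    simpa using hz

lemma Len.list_prod {H : Type} [Group H] {l : H → ℕ} (hl : Len l) (S : List H) (n : ℕ)
    (h : ∀ a ∈ S, l a ≤ n) : l S.prod ≤ S.length * n := by
  induction S with
  | nil => simp [hl.one]
  | cons a S ih =>
    have h1 := ih (fun b hb => h b (by simp [hb]))
    have h2 := h a (by simp)
    have := hl.mul a S.prod
    rw [List.prod_cons, List.length_cons, Nat.succ_mul]; omega

section
variable (r k : ℕ) (ranks : Fin k → ℕ)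

/-- Colour of a generator. -/
def colB : B r k ranks → Fin r ⊕ Fin k
  | Sum.inl j => Sum.inl j
  | Sum.inr p => Sum.inr p.1

/-- Embedding of generators of one abelian factor. -/
def inB (i : Fin k) (j : Fin (ranks i)) : B r k ranks := Sum.inr ⟨i, j⟩

lemma inB_inj (i : Fin k) : Function.Injective (inB r k ranks i) := by
  intro a b h
  simpa [inB] using h

/-- Evaluation of abelian vectors in a factor. -/
noncomputable def thetaG : Fin r ⊕ Fin k → Multiplicative (B r k ranks →₀ ℤ) →* G r k ranks
  | Sum.inl j => (zpowersHom (G r k ranks) (gen r k ranks (Sum.inl j))).comp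
      (AddMonoidHom.toMultiplicative (Finsupp.applyAddHom (Sum.inl j : B r k ranks)))
  | Sum.inr i => (incA r k ranks i).comp
      (AddMonoidHom.toMultiplicative (Finsupp.comapDomain.addMonoidHom (inB_inj r k ranks i)))

lemma thetaG_inl (j : Fin r) (a : Multiplicative (B r k ranks →₀ ℤ)) :
    thetaG r k ranks (Sum.inl j) a =
      gen r k ranks (Sum.inl j) ^ (Multiplicative.toAdd a (Sum.inl j)) := rfl

lemma thetaG_inr (i : Fin k) (a : Multiplicative (B r k ranks →₀ ℤ)) :
    thetaG r k ranks (Sum.inr i) a = incA r k ranks i (Multiplicative.ofAdd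
      (Finsupp.comapDomain (inB r k ranks i) (Multiplicative.toAdd a)
        (inB_inj r k ranks i).injOn)) := rfl

lemma thetaG_gen (b : B r k ranks) : thetaG r k ranks (colB r k ranks b)
    (Multiplicative.ofAdd (Finsupp.single b 1)) = gen r k ranks b := by
  rcases b with j | ⟨i, j⟩
  · change thetaG r k ranks (Sum.inl j) _ = _
    rw [thetaG_inl]; simp
  · change thetaG r k ranks (Sum.inr i) _ = _
    rw [thetaG_inr, ← incA_of]
    congr 2
    exact Finsupp.comapDomain_single (inB r k ranks i) j 1 _

lemma thetaG_len (i : Fin r ⊕ Fin k) (a : Multiplicative (B r k ranks →₀ ℤ)) (n : ℕ)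
    (h : ∀ b, |Multiplicative.toAdd a b| ≤ (n : ℤ)) :
    wl r k ranks (thetaG r k ranks i a) ≤ Fintype.card (B r k ranks) * n := by
  rcases i with j | i
  · rw [thetaG_inl]
    have h1 := (wl_len r k ranks).zpow (gen r k ranks (Sum.inl j)) (wl_gen r k ranks _) _ n
      (h (Sum.inl j))
    have h2 : 1 ≤ Fintype.card (B r k ranks) := Fintype.card_pos_iff.2 ⟨Sum.inl j⟩
    nlinarith
  · rw [thetaG_inr, finsupp_prod]
    refine ((wl_len r k ranks).list_prod _ n ?_).trans ?_
    · intro y hy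
      obtain ⟨j, _, rfl⟩ := List.mem_map.1 hy
      rw [incA_of]
      apply (wl_len r k ranks).zpow _ (wl_gen r k ranks _)
      exact h (inB r k ranks i j)
    · apply Nat.mul_le_mul_right
      rw [List.length_map, List.length_finRange]
      have := Fintype.card_le_of_injective _ (inB_inj r k ranks i)
      simpa using this

/-- Map to the free product of coloured copies. -/
noncomputable def psiG : G r k ranks →*
    Monoid.CoprodI (fun _ : Fin r ⊕ Fin k => Multiplicative (B r k ranks →₀ ℤ)) :=
  Monoid.CoprodI.lift (fun o => match o with
    | none => (FreeGroup.lift (fun j => Monoid.CoprodI.of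
        (M := fun _ : Fin r ⊕ Fin k => Multiplicative (B r k ranks →₀ ℤ)) (i := Sum.inl j)
        (Multiplicative.ofAdd (Finsupp.single (Sum.inl j) 1))) : FreeGroup (Fin r) →* _)
    | some i => ((Monoid.CoprodI.of
        (M := fun _ : Fin r ⊕ Fin k => Multiplicative (B r k ranks →₀ ℤ)) (i := Sum.inr i)).comp
        (AddMonoidHom.toMultiplicative (Finsupp.mapDomain.addMonoidHom (inB r k ranks i))) :
          Multiplicative (Fin (ranks i) →₀ ℤ) →* _))

lemma psiG_gen (b : B r k ranks) : psiG r k ranks (gen r k ranks b) = Monoid.CoprodI.of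
    (M := fun _ : Fin r ⊕ Fin k => Multiplicative (B r k ranks →₀ ℤ)) (i := colB r k ranks b)
    (Multiplicative.ofAdd (Finsupp.single b 1)) := by
  rcases b with j | ⟨i, j⟩
  · unfold psiG
    rw [gen, Monoid.CoprodI.lift_of]
    exact FreeGroup.lift_apply_of
  · unfold psiG
    rw [gen, Monoid.CoprodI.lift_of]
    change Monoid.CoprodI.of (M := fun _ : Fin r ⊕ Fin k => Multiplicative (B r k ranks →₀ ℤ))
      (i := Sum.inr i) (Multiplicative.ofAdd (Finsupp.mapDomain (inB r k ranks i)
        (Finsupp.single j 1))) = _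
    rw [Finsupp.mapDomain_single]
    rfl

end

lemma numeric (Q c m' g s K n0 M : ℕ) (hg : 1 ≤ g) (hs : s = g + m' + c) (hK : K = (Q + 1) * c + 1)
    (hn0 : n0 = 4 * c + M) (hM : M = m' + 1) :
    3 * (2 * (6 * (K * n0) + 10 * (K * n0) * n0 + (2 * (K * n0) + K) * M) +
        (2 * (K * n0) + K)) ≤ 2000 * (Q + 2) * s ^ 20 := by
  have s1 : 1 ≤ s := by omega
  have k1 : K ≤ (Q + 2) * s := by rw [hK]; nlinarith [show c ≤ s by omega]
  have n1 : n0 ≤ 5 * s := by omega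
  have m1 : M ≤ s := by omega
  have p1 : s ≤ s ^ 3 := by simpa using Nat.pow_le_pow_right s1 (show 1 ≤ 3 by norm_num)
  have p2 : s ^ 2 ≤ s ^ 3 := Nat.pow_le_pow_right s1 (by norm_num)
  have p3 : s ^ 3 ≤ s ^ 20 := Nat.pow_le_pow_right s1 (by norm_num)
  set q := Q + 2
  calc _ ≤ 3 * (2 * (6 * (q * s * (5 * s)) + 10 * (q * s * (5 * s)) * (5 * s) +
        (2 * (q * s * (5 * s)) + q * s) * s) + (2 * (q * s * (5 * s)) + q * s)) := by gcongr
    _ = q * (1560 * s ^ 3 + 216 * s ^ 2 + 3 * s) := by ring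
    _ ≤ q * (1560 * s ^ 3 + 216 * s ^ 3 + 3 * s ^ 3) := by gcongr
    _ = 1779 * q * s ^ 3 := by ring
    _ ≤ 2000 * q * s ^ 20 := by gcongr; norm_num

/-- Minimal solutions of the standard non-orientable quadratic equation
(∏ᵢ xᵢ²)·(∏ⱼ zⱼ⁻¹Cⱼzⱼ)·C = 1 of genus g ≥ 1 with m−1 conjugated coefficients
(here m' = m − 1 ≥ 0, so m ≥ 1) over the free product G are bounded by N·s²⁰ where
s = g + (m−1) + Σ|Cⱼ| + |C| and N depends only on G. -/
theorem standard_nonorientable_minimal_solution_bound (r k : ℕ) (ranks : Fin k → ℕ) :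
    ∃ N : ℕ, ∀ (g : ℕ), 1 ≤ g → ∀ (m' : ℕ) (C : Fin m' → G r k ranks) (Clast : G r k ranks),
      (∃ (x : Fin g → G r k ranks) (z : Fin m' → G r k ranks),
        (List.ofFn fun i => x i * x i).prod *
          (List.ofFn fun j => (z j)⁻¹ * C j * z j).prod * Clast = 1) →
      ∃ (x : Fin g → G r k ranks) (z : Fin m' → G r k ranks),
        (List.ofFn fun i => x i * x i).prod *
          (List.ofFn fun j => (z j)⁻¹ * C j * z j).prod * Clast = 1 ∧
        (∀ i : Fin g, wl r k ranks (x i) ≤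
          N * (g + m' + (∑ j, wl r k ranks (C j)) + wl r k ranks Clast) ^ 20) ∧
        (∀ j : Fin m', wl r k ranks (z j) ≤
          N * (g + m' + (∑ j, wl r k ranks (C j)) + wl r k ranks Clast) ^ 20) := by
  refine ⟨2000 * (Fintype.card (B r k ranks) + 2), ?_⟩
  rintro g hg m' C Clast ⟨x, z, hxz⟩
  choose wd hwd1 hwd2 using wl_word r k ranks
  set C' : Fin (m' + 1) → G r k ranks := Fin.snoc (α := fun _ => G r k ranks) C Clast with hC'
  set z' : Fin (m' + 1) → G r k ranks := Fin.snoc (α := fun _ => G r k ranks) z 1 with hz'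
  have hcsum : ∑ j, (wd (C' j)).length = (∑ j, wl r k ranks (C j)) + wl r k ranks Clast := by
    rw [Fin.sum_univ_castSucc]
    simp [hC', hwd1]
  obtain ⟨y, v, h1, h2, h3⟩ := core (gen r k ranks) (wl_len r k ranks) (wl_gen r k ranks)
    (colB r k ranks) (thetaG r k ranks) (thetaG_gen r k ranks) (Fintype.card (B r k ranks))
    (thetaG_len r k ranks) (psiG r k ranks) (psiG_gen r k ranks) hg
    (Sum.elim (fun i => wd (x i)) (Sum.elim (fun j => wd (z' j)) (fun j => wd (C' j))))
    (by
      simp only [Sum.elim_inl, Sum.elim_inr, hwd2]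
      rw [List.ofFn_succ' (fun j => (z' j)⁻¹ * C' j * z' j), List.concat_eq_append,
        List.prod_append]
      simp only [hz', hC', Fin.snoc_castSucc, Fin.snoc_last]
      simp only [List.prod_singleton, inv_one, one_mul, mul_one]
      rw [← mul_assoc]
      exact hxz)
    _ _ _ rfl rfl rfl
  simp only [Sum.elim_inr, hwd2] at h1
  simp only [Sum.elim_inr, hcsum] at h2 h3
  have num := numeric (Fintype.card (B r k ranks))
    ((∑ j, wl r k ranks (C j)) + wl r k ranks Clast) m' g
    (g + m' + (∑ j, wl r k ranks (C j)) + wl r k ranks Clast) _ _ _ hg (by omega) rfl rfl rfl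
  set P := 2 * (6 * (((Fintype.card (B r k ranks) + 1) *
    ((∑ j, wl r k ranks (C j)) + wl r k ranks Clast) + 1) * (4 *
    ((∑ j, wl r k ranks (C j)) + wl r k ranks Clast) + (m' + 1))) + 10 *
    (((Fintype.card (B r k ranks) + 1) *
    ((∑ j, wl r k ranks (C j)) + wl r k ranks Clast) + 1) * (4 *
    ((∑ j, wl r k ranks (C j)) + wl r k ranks Clast) + (m' + 1))) * (4 *
    ((∑ j, wl r k ranks (C j)) + wl r k ranks Clast) + (m' + 1)) +
    (2 * (((Fintype.card (B r k ranks) + 1) *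
    ((∑ j, wl r k ranks (C j)) + wl r k ranks Clast) + 1) * (4 *
    ((∑ j, wl r k ranks (C j)) + wl r k ranks Clast) + (m' + 1))) +
    ((Fintype.card (B r k ranks) + 1) *
    ((∑ j, wl r k ranks (C j)) + wl r k ranks Clast) + 1)) * (m' + 1)) +
    (2 * (((Fintype.card (B r k ranks) + 1) *
    ((∑ j, wl r k ranks (C j)) + wl r k ranks Clast) + 1) * (4 *
    ((∑ j, wl r k ranks (C j)) + wl r k ranks Clast) + (m' + 1))) +
    ((Fintype.card (B r k ranks) + 1) *
    ((∑ j, wl r k ranks (C j)) + wl r k ranks Clast) + 1)) with hP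
  have hl := wl_len r k ranks
  set q := v (Fin.last m') with hq
  refine ⟨fun i => q⁻¹ * y i * q, fun j => (v j.castSucc)⁻¹ * q, ?_, ?_, ?_⟩
  · rw [List.ofFn_succ' (fun j => v j * C' j * (v j)⁻¹), List.concat_eq_append,
        List.prod_append] at h1
    simp only [hC', Fin.snoc_castSucc, Fin.snoc_last, List.prod_singleton, ← hq] at h1
    have e := congrArg (MulAut.conj q⁻¹) h1
    rw [map_mul, map_mul, map_list_prod, map_list_prod, List.map_ofFn, List.map_ofFn, map_one,
      ← mul_assoc] at e
    rw [← e]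
    congr 1
    · congr 3
      · congr 1
        funext i
        simp only [Function.comp, MulAut.conj_apply]; group
      · congr 1
        funext j
        simp only [Function.comp, MulAut.conj_apply]; group
    · simp only [MulAut.conj_apply]; group
  · intro i
    have e1 := hl.mul (q⁻¹ * y i) q
    have e2 := hl.mul q⁻¹ (y i)
    have e3 := hl.inv q
    have e4 : wl r k ranks (y i) ≤ P := h2 i
    have e5 : wl r k ranks q ≤ P := h3 (Fin.last m')
    change wl r k ranks (q⁻¹ * y i * q) ≤ _
    clear_value P q
    refine le_trans ?_ num
    clear num h1 h2 h3
    omega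
  · intro j
    have e1 := hl.mul (v j.castSucc)⁻¹ q
    have e3 := hl.inv (v j.castSucc)
    have e4 : wl r k ranks (v j.castSucc) ≤ P := h3 j.castSucc
    have e5 : wl r k ranks q ≤ P := h3 (Fin.last m')
    change wl r k ranks ((v j.castSucc)⁻¹ * q) ≤ _
    refine le_trans ?_ num
    clear_value P q
    clear num h1 h2 h3
    omega

end Stmt3
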